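/- arXiv:1308.2034 — 2 statements merged into one kernel-verified Lean document; each statement's English description precedes it below -/
import Mathlib

section
/- Let R be Koszul and M a finitely generated graded R-module. If the i-th syzygy module Ω_i^R(M) is componentwise linear, then Ω_j^R(M) is componentwise linear for all j ≥ i. -/
/-!  Setup for statements about componentwise regularity over a standard graded
`K`-algebra `R` with grading `𝒜 : ℤ → Submodule K R`: graded modules, graded
free resolutions, Castelnuovo–Mumford regularity bounds, Koszulness and
componentwise notions. -/

namespace CregPaperG

variable {K : Type*} [Field K] {R : Type*} [CommRing R] [Algebra K R]

/-- `R` with grading `𝒜` is a standard graded `K`-algebra: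
nothing in negative degrees, `R_0 = K·1`, and `R` generated in degree `1`. -/
def IsStdGraded (𝒜 : ℤ → Submodule K R) : Prop :=
  (∀ i : ℤ, i < 0 → 𝒜 i = ⊥) ∧ 𝒜 0 = 1 ∧
    ∀ i : ℕ, 𝒜 ((i : ℤ) + 1) = 𝒜 1 * 𝒜 (i : ℤ)

/-- the homogeneous maximal ideal `m = ⊕_{i>0} 𝒜_i` of `R`. -/
def mIdealG (𝒜 : ℤ → Submodule K R) : Ideal R :=
  Ideal.span (⋃ i : {i : ℤ // i ≠ 0}, (𝒜 i.1 : Set R))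

/-- A graded free resolution `⋯ → R^{rk 1} → R^{rk 0} → N → 0` of a submodule
`N` of a graded `R`-module `(M, ℳ)`, with degree shifts `sh i` and all maps
graded of degree `0`. -/
structure GRes (𝒜 : ℤ → Submodule K R) {M : Type*} [AddCommGroup M] [Module R M]
    [Module K M] [IsScalarTower K R M] (ℳ : ℤ → Submodule K M) (N : Submodule R M) where
  rk : ℕ → ℕ
  sh : (i : ℕ) → Fin (rk i) → ℤ
  aug : (Fin (rk 0) → R) →ₗ[R] M
  diff : (i : ℕ) → ((Fin (rk (i+1)) → R) →ₗ[R] (Fin (rk i) → R))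
  aug_range : LinearMap.range aug = N
  aug_hom : ∀ l, aug (Pi.single l 1) ∈ ℳ (sh 0 l)
  diff_hom : ∀ i l v, diff i (Pi.single l 1) v ∈ 𝒜 (sh (i+1) l - sh i v)
  ex0 : LinearMap.range (diff 0) = LinearMap.ker aug
  exs : ∀ i, LinearMap.range (diff (i+1)) = LinearMap.ker (diff i)

/-- minimality: the entries of all differential matrices lie in `m`. -/
def GRes.Minimal {𝒜 : ℤ → Submodule K R} {M : Type*} [AddCommGroup M] [Module R M]
    [Module K M] [IsScalarTower K R M] {ℳ : ℤ → Submodule K M} {N : Submodule R M}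
    (res : GRes 𝒜 ℳ N) : Prop :=
  ∀ i x l, res.diff i x l ∈ mIdealG 𝒜

/-- `reg_R(N) ≤ r`: there is a minimal graded free resolution of `N` with all
shifts in homological degree `i` bounded by `i + r`. -/
def GRegLE (𝒜 : ℤ → Submodule K R) {M : Type*} [AddCommGroup M] [Module R M]
    [Module K M] [IsScalarTower K R M] (ℳ : ℤ → Submodule K M) (N : Submodule R M)
    (r : ℤ) : Prop :=
  ∃ res : GRes 𝒜 ℳ N, res.Minimal ∧ ∀ i l, res.sh i l ≤ (i : ℤ) + r

/-- `R` is Koszul: the residue field `K = R/m` has a linear minimal graded free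
resolution; equivalently, the maximal ideal `m` (as a graded submodule of `R`)
has a minimal graded free resolution with `i`-th shifts all equal to `i + 1`. -/
def Koszul (𝒜 : ℤ → Submodule K R) : Prop :=
  ∃ res : GRes 𝒜 𝒜 (mIdealG 𝒜), res.Minimal ∧ ∀ i l, res.sh i l = (i : ℤ) + 1

/-- `M_{⟨a⟩}`: the `R`-submodule generated by the degree-`a` component. -/
def gcomp {M : Type*} [AddCommGroup M] [Module R M] [Module K M]
    [IsScalarTower K R M] (ℳ : ℤ → Submodule K M) (a : ℤ) : Submodule R M :=
  Submodule.span R (ℳ a : Set M)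

/-- the degree-`a` component of the graded free module `⊕_v R(-s_v)`. -/
def freeGrade (𝒜 : ℤ → Submodule K R) {k : ℕ} (s : Fin k → ℤ) (a : ℤ) :
    Submodule K (Fin k → R) where
  carrier := {f | ∀ v, f v ∈ 𝒜 (a - s v)}
  add_mem' := by intro f g hf hg v; exact (𝒜 _).add_mem (hf v) (hg v)
  zero_mem' := by intro v; exact (𝒜 _).zero_mem
  smul_mem' := by intro c f hf v; exact (𝒜 _).smul_mem c (hf v)

/-- componentwise linearity of a submodule `N` of the graded free module
`⊕_v R(-s_v)`: for every `a`, the submodule generated by the degree-`a`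
elements of `N` is zero or has regularity `a`. -/
def GCompLinear (𝒜 : ℤ → Submodule K R) {k : ℕ} (s : Fin k → ℤ)
    (N : Submodule R (Fin k → R)) : Prop :=
  ∀ a : ℤ,
    Submodule.span R ((freeGrade 𝒜 s a : Set (Fin k → R)) ∩ N) = ⊥ ∨
    GRegLE 𝒜 (freeGrade 𝒜 s)
      (Submodule.span R ((freeGrade 𝒜 s a : Set (Fin k → R)) ∩ N)) a

end CregPaperG

namespace CregPaperG

section Families

universe u

variable {K : Type*} [Field K] {R : Type u} [CommRing R] [Algebra K R]

/-- A family of additive subgroups of an `R`-module, indexed by degrees, that is stable under the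
action of the graded ring `(R, 𝒜)`. -/
@[ext]
structure GradedFamily (𝒜 : ℤ → Submodule K R) (X : Type*) [AddCommGroup X] [Module R X] where
  piece : ℤ → AddSubgroup X
  smul_mem' : ∀ {i j : ℤ} {r : R} {x : X}, r ∈ 𝒜 i → x ∈ piece j → r • x ∈ piece (i + j)

variable {𝒜 : ℤ → Submodule K R}
variable {X Y Z : Type*} [AddCommGroup X] [Module R X] [AddCommGroup Y] [Module R Y]
  [AddCommGroup Z] [Module R Z]

namespace GradedFamily

theorem smul_mem (A : GradedFamily 𝒜 X) {i j d : ℤ} {r : R} {x : X} (hr : r ∈ 𝒜 i)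
    (hx : x ∈ A.piece j) (hd : i + j = d) : r • x ∈ A.piece d :=
  hd ▸ A.smul_mem' hr hx

/-- The zero family. -/
def zero (𝒜 : ℤ → Submodule K R) (X : Type*) [AddCommGroup X] [Module R X] :
    GradedFamily 𝒜 X where
  piece _ := ⊥
  smul_mem' := by
    intro i j r x _ hx
    rw [AddSubgroup.mem_bot] at hx ⊢
    rw [hx, smul_zero]

theorem mem_zero {d : ℤ} {x : X} : x ∈ (zero 𝒜 X).piece d ↔ x = 0 := AddSubgroup.mem_bot

/-- The family with all degrees raised by `c`. -/
def shift (A : GradedFamily 𝒜 X) (c : ℤ) : GradedFamily 𝒜 X where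
  piece d := A.piece (d - c)
  smul_mem' hr hx := A.smul_mem hr hx (by ring)

theorem mem_shift {A : GradedFamily 𝒜 X} {c d : ℤ} {x : X} :
    x ∈ (A.shift c).piece d ↔ x ∈ A.piece (d - c) := Iff.rfl

/-- The intersection of a family with a submodule. -/
def inter (A : GradedFamily 𝒜 X) (N : Submodule R X) : GradedFamily 𝒜 X where
  piece d := A.piece d ⊓ N.toAddSubgroup
  smul_mem' hr hx := ⟨A.smul_mem' hr hx.1, N.smul_mem _ hx.2⟩

theorem mem_inter {A : GradedFamily 𝒜 X} {N : Submodule R X} {d : ℤ} {x : X} :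
    x ∈ (A.inter N).piece d ↔ x ∈ A.piece d ∧ x ∈ N := Iff.rfl

/-- The kernel of a linear map, restricted to the pieces of a family. -/
abbrev ker (A : GradedFamily 𝒜 X) (g : X →ₗ[R] Y) : GradedFamily 𝒜 X :=
  A.inter (LinearMap.ker g)

theorem mem_ker {A : GradedFamily 𝒜 X} {g : X →ₗ[R] Y} {d : ℤ} {x : X} :
    x ∈ (A.ker g).piece d ↔ x ∈ A.piece d ∧ g x = 0 := Iff.rfl

/-- The product of two families. -/
def prod (A : GradedFamily 𝒜 X) (B : GradedFamily 𝒜 Y) : GradedFamily 𝒜 (X × Y) where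
  piece d := (A.piece d).prod (B.piece d)
  smul_mem' hr hx := ⟨A.smul_mem' hr hx.1, B.smul_mem' hr hx.2⟩

/-- The truncation of a family in degrees at least `a`. -/
def trunc (hneg : ∀ i : ℤ, i < 0 → 𝒜 i = ⊥) (A : GradedFamily 𝒜 X) (a : ℤ) :
    GradedFamily 𝒜 X where
  piece d :=
    { carrier := {x | x ∈ A.piece d ∧ (d < a → x = 0)}
      add_mem' := fun hx hy => ⟨add_mem hx.1 hy.1, fun h => by rw [hx.2 h, hy.2 h, add_zero]⟩
      zero_mem' := ⟨zero_mem _, fun _ => rfl⟩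
      neg_mem' := fun hx => ⟨neg_mem hx.1, fun h => by rw [hx.2 h, neg_zero]⟩ }
  smul_mem' := by
    intro i j r x hr hx
    refine ⟨A.smul_mem' hr hx.1, fun h => ?_⟩
    rcases lt_or_ge i 0 with hi | hi
    · rw [hneg i hi, Submodule.mem_bot] at hr
      rw [hr, zero_smul]
    · rw [hx.2 (by omega), smul_zero]

theorem mem_trunc {hneg : ∀ i : ℤ, i < 0 → 𝒜 i = ⊥} {A : GradedFamily 𝒜 X} {a d : ℤ} {x : X} :
    x ∈ (A.trunc hneg a).piece d ↔ x ∈ A.piece d ∧ (d < a → x = 0) := Iff.rfl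

variable {ι : Type*}

/-- The vectors of a family supported in a given set of coordinates. -/
def supported (A : GradedFamily 𝒜 (ι → R)) (T : Set ι) : GradedFamily 𝒜 (ι → R) where
  piece d :=
    { carrier := {f | f ∈ A.piece d ∧ ∀ v, v ∉ T → f v = 0}
      add_mem' := fun hf hg => ⟨add_mem hf.1 hg.1, fun v hv => by
        rw [Pi.add_apply, hf.2 v hv, hg.2 v hv, add_zero]⟩
      zero_mem' := ⟨zero_mem _, fun _ _ => rfl⟩
      neg_mem' := fun hf => ⟨neg_mem hf.1, fun v hv => by
        rw [Pi.neg_apply, hf.2 v hv, neg_zero]⟩ }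
  smul_mem' hr hx := ⟨A.smul_mem' hr hx.1, fun v hv => by
    rw [Pi.smul_apply, hx.2 v hv, smul_zero]⟩

theorem mem_supported {A : GradedFamily 𝒜 (ι → R)} {T : Set ι} {d : ℤ} {f : ι → R} :
    f ∈ (A.supported T).piece d ↔ f ∈ A.piece d ∧ ∀ v, v ∉ T → f v = 0 := Iff.rfl

section Graded

variable [GradedAlgebra 𝒜]

variable (𝒜) in
/-- The ring itself, as a graded family. -/
def self : GradedFamily 𝒜 R where
  piece d := (𝒜 d).toAddSubgroup
  smul_mem' hr hx := SetLike.mul_mem_graded hr hx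

theorem mem_self {d : ℤ} {x : R} : x ∈ (self 𝒜).piece d ↔ x ∈ 𝒜 d := Iff.rfl

variable (𝒜) in
/-- The graded free module `⊕_v R(-s_v)`. -/
def free (s : ι → ℤ) : GradedFamily 𝒜 (ι → R) where
  piece d :=
    { carrier := {f | ∀ v, f v ∈ 𝒜 (d - s v)}
      add_mem' := fun hf hg v => add_mem (hf v) (hg v)
      zero_mem' := fun v => zero_mem _
      neg_mem' := fun hf v => neg_mem (hf v) }
  smul_mem' := by
    intro i j r x hr hx v
    have := SetLike.mul_mem_graded hr (hx v)
    rwa [← add_sub_assoc] at this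

theorem mem_free {s : ι → ℤ} {d : ℤ} {f : ι → R} :
    f ∈ (free 𝒜 s).piece d ↔ ∀ v, f v ∈ 𝒜 (d - s v) := Iff.rfl

variable [Fintype ι]

theorem linearCombination_mem (A : GradedFamily 𝒜 X) {s : ι → ℤ} {x : ι → X}
    (hx : ∀ l, x l ∈ A.piece (s l)) {d : ℤ} {f : ι → R} (hf : f ∈ (free 𝒜 s).piece d) :
    Fintype.linearCombination R x f ∈ A.piece d := by
  rw [Fintype.linearCombination_apply]
  exact sum_mem fun l _ => A.smul_mem (hf l) (hx l) (by ring)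

/-- Homogeneous elements `x l` of degree `s l` generate the family degree by degree. -/
structure IsCover (A : GradedFamily 𝒜 X) (s : ι → ℤ) (x : ι → X) : Prop where
  mem : ∀ l, x l ∈ A.piece (s l)
  surj : ∀ {d : ℤ} {y : X}, y ∈ A.piece d →
    ∃ f ∈ (free 𝒜 s).piece d, Fintype.linearCombination R x f = y

/-- The graded syzygies of homogeneous elements `x l` of degree `s l`. -/
abbrev syz (𝒜 : ℤ → Submodule K R) [GradedAlgebra 𝒜] (s : ι → ℤ) (x : ι → X) :
    GradedFamily 𝒜 (ι → R) :=
  (free 𝒜 s).ker (Fintype.linearCombination R x)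

end Graded

/-- Degreewise short exact sequences of graded families. -/
structure ShortExact (f : X →ₗ[R] Y) (g : Y →ₗ[R] Z) (A : GradedFamily 𝒜 X)
    (B : GradedFamily 𝒜 Y) (C : GradedFamily 𝒜 Z) : Prop where
  map_left : ∀ {d x}, x ∈ A.piece d → f x ∈ B.piece d
  inj : ∀ {d x}, x ∈ A.piece d → f x = 0 → x = 0
  comp : ∀ {d x}, x ∈ A.piece d → g (f x) = 0
  exact : ∀ {d y}, y ∈ B.piece d → g y = 0 → ∃ x ∈ A.piece d, f x = y
  map_right : ∀ {d y}, y ∈ B.piece d → g y ∈ C.piece d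
  surj : ∀ {d z}, z ∈ C.piece d → ∃ y ∈ B.piece d, g y = z

theorem shortExact_ker {g : Y →ₗ[R] Z} {B : GradedFamily 𝒜 Y} {C : GradedFamily 𝒜 Z}
    (hmap : ∀ {d y}, y ∈ B.piece d → g y ∈ C.piece d)
    (hsurj : ∀ {d z}, z ∈ C.piece d → ∃ y ∈ B.piece d, g y = z) :
    ShortExact LinearMap.id g (B.ker g) B C where
  map_left hx := hx.1
  inj _ h := h
  comp hx := hx.2
  exact hy h := ⟨_, ⟨hy, h⟩, rfl⟩
  map_right := hmap
  surj := hsurj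

theorem ShortExact.trunc {f : X →ₗ[R] Y} {g : Y →ₗ[R] Z}
    {A : GradedFamily 𝒜 X} {B : GradedFamily 𝒜 Y} {C : GradedFamily 𝒜 Z}
    (h : ShortExact f g A B C) (hneg : ∀ i : ℤ, i < 0 → 𝒜 i = ⊥) (a : ℤ) :
    ShortExact f g (A.trunc hneg a) (B.trunc hneg a) (C.trunc hneg a) where
  map_left hx := ⟨h.map_left hx.1, fun hd => by rw [hx.2 hd, map_zero]⟩
  inj hx := h.inj hx.1
  comp hx := h.comp hx.1
  exact hy h0 := by
    obtain ⟨x, hx, rfl⟩ := h.exact hy.1 h0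
    exact ⟨x, ⟨hx, fun hd => h.inj hx (hy.2 hd)⟩, rfl⟩
  map_right hy := ⟨h.map_right hy.1, fun hd => by rw [hy.2 hd, map_zero]⟩
  surj := by
    intro d z hz
    rcases lt_or_ge d a with hd | hd
    · exact ⟨0, zero_mem _, by rw [map_zero, hz.2 hd]⟩
    · obtain ⟨y, hy, rfl⟩ := h.surj hz.1
      exact ⟨y, ⟨hy, fun hd' => absurd hd' (not_lt.2 hd)⟩, rfl⟩

theorem shift_trunc (A : GradedFamily 𝒜 X)
    (hneg : ∀ i : ℤ, i < 0 → 𝒜 i = ⊥) (a c : ℤ) :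
    (A.trunc hneg a).shift c = (A.shift c).trunc hneg (a + c) := by
  ext d x
  rw [mem_shift, mem_trunc, mem_trunc, mem_shift, sub_lt_iff_lt_add]

theorem linearCombination_single {ι : Type*} [Fintype ι] [DecidableEq ι]
    (φ : (ι → R) →ₗ[R] X) :
    Fintype.linearCombination R (fun l => φ (Pi.single l 1)) = φ := by
  refine LinearMap.pi_ext fun l r => ?_
  rw [Fintype.linearCombination_apply_single, ← map_smul, ← Pi.single_smul, smul_eq_mul, mul_one]

end GradedFamily

theorem IsStdGraded.mem_mul (hstd : IsStdGraded 𝒜) {p q : ℤ} (hp : 0 ≤ p) (hq : 0 ≤ q) {r : R}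
    (hr : r ∈ 𝒜 (p + q)) : r ∈ 𝒜 p * 𝒜 q := by
  have hpow : ∀ n : ℕ, 𝒜 n = 𝒜 1 ^ n := by
    intro n
    induction n with
    | zero => rw [pow_zero, Nat.cast_zero, hstd.2.1]
    | succ n ih => rw [Nat.cast_succ, hstd.2.2, ih, pow_succ']
  lift p to ℕ using hp
  lift q to ℕ using hq
  rwa [← Nat.cast_add, hpow, pow_add, ← hpow, ← hpow] at hr

open GradedFamily

variable [GradedAlgebra 𝒜]

/-- The family has a finite graded free resolution whose generators in homological degree `i`
have degree at most `i + r`, for all `i < n`. -/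
def RegLE : ℕ → ∀ {X : Type u} [AddCommGroup X] [Module R X], GradedFamily 𝒜 X → ℤ → Prop
  | 0, _, _, _, _, _ => True
  | n + 1, X, _, _, A, r => ∃ (ι : Type) (_ : Fintype ι) (s : ι → ℤ) (x : ι → X),
      (∀ l, s l ≤ r) ∧ A.IsCover s x ∧ RegLE n (syz 𝒜 s x) (r + 1)

namespace RegLE

variable {X Y Z : Type u} [AddCommGroup X] [Module R X] [AddCommGroup Y] [Module R Y]
  [AddCommGroup Z] [Module R Z]

theorem mono {n : ℕ} {A : GradedFamily 𝒜 X} {r r' : ℤ} (h : RegLE n A r) (hr : r ≤ r') :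
    RegLE n A r' := by
  induction n generalizing X r r' with
  | zero => trivial
  | succ n ih =>
    obtain ⟨ι, _, s, x, hs, hx, hA⟩ := h
    exact ⟨ι, _, s, x, fun l => (hs l).trans hr, hx, ih hA (by omega)⟩

theorem of_succ {n : ℕ} {A : GradedFamily 𝒜 X} {r : ℤ} (h : RegLE (n + 1) A r) :
    RegLE n A r := by
  induction n generalizing X r with
  | zero => trivial
  | succ n ih =>
    obtain ⟨ι, _, s, x, hs, hx, hA⟩ := h
    exact ⟨ι, _, s, x, hs, hx, ih hA⟩

theorem of_eq_zero {n : ℕ} {A : GradedFamily 𝒜 X} {r : ℤ}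
    (h : ∀ {d x}, x ∈ A.piece d → x = 0) : RegLE n A r := by
  induction n generalizing X r with
  | zero => trivial
  | succ n ih =>
    refine ⟨Empty, inferInstance, Empty.elim, Empty.elim, fun l => l.elim,
      ⟨fun l => l.elim, fun {d y} hy => ⟨0, zero_mem _, ?_⟩⟩, ih fun _ => Subsingleton.elim _ _⟩
    rw [h hy, map_zero]

theorem shift {n : ℕ} {A : GradedFamily 𝒜 X} {r : ℤ} (h : RegLE n A r) (c : ℤ) :
    RegLE n (A.shift c) (r + c) := by
  induction n generalizing X r with
  | zero => trivial
  | succ n ih =>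
    obtain ⟨ι, _, s, x, hs, hx, hA⟩ := h
    have hfree : ∀ {d : ℤ} {f : ι → R}, f ∈ (free 𝒜 fun l => s l + c).piece d ↔
        f ∈ (free 𝒜 s).piece (d - c) := by
      intro d f
      simp only [mem_free, sub_sub, add_comm c]
    refine ⟨ι, _, fun l => s l + c, x, fun l => add_le_add_left (hs l) c, ⟨fun l => ?_, ?_⟩, ?_⟩
    · rw [mem_shift, add_sub_cancel_right]
      exact hx.mem l
    · intro d y hy
      obtain ⟨f, hf, hfy⟩ := hx.surj hy
      exact ⟨f, hfree.2 hf, hfy⟩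
    · have : syz 𝒜 (fun l => s l + c) x = (syz 𝒜 s x).shift c := by
        ext d f
        rw [mem_shift, mem_ker, mem_ker, hfree]
      rw [this, add_right_comm]
      exact ih hA

theorem middle {n : ℕ} {f : X →ₗ[R] Y} {g : Y →ₗ[R] Z} {A : GradedFamily 𝒜 X}
    {B : GradedFamily 𝒜 Y} {C : GradedFamily 𝒜 Z} (h : ShortExact f g A B C) {r : ℤ}
    (hA : RegLE n A r) (hC : RegLE n C r) : RegLE n B r := by
  induction n generalizing X Y Z r with
  | zero => trivial
  | succ n ih =>
    obtain ⟨ι, _, s, x, hs, hx, hA⟩ := hA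
    obtain ⟨κ, _, t, z, ht, hz, hC⟩ := hC
    choose y hy hyz using fun l => h.surj (hz.mem l)
    have hsum : ∀ p : ι ⊕ κ → R, Fintype.linearCombination R (Sum.elim (f ∘ x) y) p =
        f (Fintype.linearCombination R x (p ∘ Sum.inl)) +
          Fintype.linearCombination R y (p ∘ Sum.inr) := by
      intro p
      simp [Fintype.linearCombination_apply, map_sum]
    have hgy : ∀ q : κ → R, g (Fintype.linearCombination R y q) =
        Fintype.linearCombination R z q := by
      intro q
      simp [Fintype.linearCombination_apply, map_sum, hyz]
    let inl : (ι → R) →ₗ[R] (ι ⊕ κ → R) :=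
      { toFun := fun p => Sum.elim p 0
        map_add' := fun p q => by ext (l | l) <;> simp
        map_smul' := fun c p => by ext (l | l) <;> simp }
    have hmem : ∀ l, Sum.elim (f ∘ x) y l ∈ B.piece (Sum.elim s t l) := by
      rintro (l | l)
      · exact h.map_left (hx.mem l)
      · exact hy l
    have hinr : ∀ {d : ℤ} {p : ι ⊕ κ → R}, p ∈ (free 𝒜 (Sum.elim s t)).piece d →
        p ∘ Sum.inr ∈ (free 𝒜 t).piece d := fun hp l => hp (Sum.inr l)
    have hinl : ∀ {d : ℤ} {p : ι ⊕ κ → R}, p ∈ (free 𝒜 (Sum.elim s t)).piece d →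
        p ∘ Sum.inl ∈ (free 𝒜 s).piece d := fun hp l => hp (Sum.inl l)
    have hlift : ∀ {d : ℤ} {b : Y} {q : κ → R}, b ∈ B.piece d → q ∈ (free 𝒜 t).piece d →
        Fintype.linearCombination R z q = g b → ∃ p : ι → R, p ∈ (free 𝒜 s).piece d ∧
          Fintype.linearCombination R (Sum.elim (f ∘ x) y) (Sum.elim p q) = b := by
      intro d b q hb hq hqb
      obtain ⟨a, ha, hab⟩ := h.exact
        (sub_mem hb (B.linearCombination_mem (fun l => hy l) hq)) (by rw [map_sub, hgy, hqb, sub_self])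
      obtain ⟨p, hp, hpa⟩ := hx.surj ha
      refine ⟨p, hp, ?_⟩
      rw [hsum, Sum.elim_comp_inl, Sum.elim_comp_inr, hpa, hab, sub_add_cancel]
    have helim : ∀ {d : ℤ} {p : ι → R} {q : κ → R}, p ∈ (free 𝒜 s).piece d →
        q ∈ (free 𝒜 t).piece d → Sum.elim p q ∈ (free 𝒜 (Sum.elim s t)).piece d := by
      rintro d p q hp hq (l | l)
      · exact hp l
      · exact hq l
    refine ⟨ι ⊕ κ, inferInstance, Sum.elim s t, Sum.elim (f ∘ x) y, ?_, ⟨hmem, ?_⟩,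
      ih (f := inl) (g := LinearMap.funLeft R R Sum.inr) ?_ hA hC⟩
    · rintro (l | l)
      exacts [hs l, ht l]
    · intro d b hb
      obtain ⟨q, hq, hqb⟩ := hz.surj (h.map_right hb)
      obtain ⟨p, hp, hpb⟩ := hlift hb hq hqb
      exact ⟨_, helim hp hq, hpb⟩
    · refine ⟨?_, ?_, ?_, ?_, ?_, ?_⟩
      · intro d p hp
        refine ⟨helim hp.1 (zero_mem _), ?_⟩
        change Fintype.linearCombination R (Sum.elim (f ∘ x) y) (Sum.elim p 0) = 0
        rw [hsum, Sum.elim_comp_inl, Sum.elim_comp_inr, mem_ker.1 hp |>.2, map_zero, map_zero,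
          add_zero]
      · intro d p _ hp0
        ext l
        exact congrFun hp0 (Sum.inl l)
      · intro d p _
        ext l
        rfl
      · intro d p hp hp0
        have hp' : p ∘ Sum.inr = 0 := hp0
        have h0 := mem_ker.1 hp |>.2
        rw [hsum, hp', map_zero, add_zero] at h0
        refine ⟨p ∘ Sum.inl, ⟨hinl hp.1, h.inj (A.linearCombination_mem hx.mem (hinl hp.1)) h0⟩, ?_⟩
        ext (l | l)
        · rfl
        · exact (congrFun hp' l).symm
      · intro d p hp
        refine ⟨hinr hp.1, ?_⟩
        change Fintype.linearCombination R z (p ∘ Sum.inr) = 0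
        have h0 := congrArg g (mem_ker.1 hp |>.2)
        rwa [hsum, map_add, h.comp (A.linearCombination_mem hx.mem (hinl hp.1)), zero_add, hgy,
          map_zero] at h0
      · intro d q hq
        obtain ⟨p, hp, hp0⟩ := hlift (zero_mem _) hq.1 (by rw [map_zero]; exact hq.2)
        exact ⟨Sum.elim p q, ⟨helim hp hq.1, hp0⟩, rfl⟩

theorem right {n : ℕ} {g : Y →ₗ[R] Z} {A B : GradedFamily 𝒜 Y} {C : GradedFamily 𝒜 Z}
    (h : ShortExact LinearMap.id g A B C) {r : ℤ} (hA : RegLE n A (r + 1))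
    (hB : RegLE (n + 1) B r) : RegLE (n + 1) C r := by
  obtain ⟨ι, _, s, x, hs, hx, hB⟩ := hB
  have hg : ∀ p : ι → R, Fintype.linearCombination R (g ∘ x) p =
      g (Fintype.linearCombination R x p) := by
    intro p
    simp [Fintype.linearCombination_apply, map_sum]
  refine ⟨ι, _, s, g ∘ x, hs, ⟨fun l => h.map_right (hx.mem l), ?_⟩,
    middle (f := LinearMap.id) (g := Fintype.linearCombination R x) ?_ hB hA⟩
  · intro d z hz
    obtain ⟨y, hy, rfl⟩ := h.surj hz
    obtain ⟨p, hp, rfl⟩ := hx.surj hy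
    exact ⟨p, hp, hg p⟩
  · refine ⟨?_, fun _ h0 => h0, fun hp => hp.2, ?_, ?_, ?_⟩
    · intro d p hp
      refine ⟨hp.1, (hg p).trans ?_⟩
      rw [mem_ker.1 hp |>.2, map_zero]
    · exact fun hp h0 => ⟨_, ⟨hp.1, h0⟩, rfl⟩
    · intro d p hp
      obtain ⟨a, ha, hap⟩ := h.exact (B.linearCombination_mem hx.mem hp.1)
        ((hg p).symm.trans hp.2)
      rw [← hap]
      exact ha
    · intro d a ha
      obtain ⟨p, hp, hpa⟩ := hx.surj (h.map_left ha)
      refine ⟨p, ⟨hp, (hg p).trans ?_⟩, hpa⟩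
      rw [hpa]
      exact h.comp ha

theorem free {ι : Type} [Fintype ι] {s : ι → ℤ} {r : ℤ} (hs : ∀ l, s l ≤ r) (n : ℕ) :
    RegLE n (free 𝒜 s) r := by
  classical
  cases n with
  | zero => trivial
  | succ n =>
    have hid : ∀ p : ι → R,
        Fintype.linearCombination R (fun l : ι => (Pi.single l 1 : ι → R)) p = p := by
      intro p
      ext l
      simp [Fintype.linearCombination_apply, Finset.sum_apply, Pi.single_apply]
    refine ⟨ι, inferInstance, s, fun l => Pi.single l 1, hs, ⟨fun l v => ?_, fun {d p} hp =>
      ⟨p, hp, hid p⟩⟩, of_eq_zero fun {d p} hp => (hid p).symm.trans hp.2⟩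
    rcases eq_or_ne v l with rfl | hv
    · rw [Pi.single_eq_same, sub_self]
      exact SetLike.GradedOne.one_mem
    · rw [Pi.single_eq_of_ne hv]
      exact zero_mem _

theorem left {n : ℕ} {g : Y →ₗ[R] Z} {A B : GradedFamily 𝒜 Y} {C : GradedFamily 𝒜 Z}
    (h : ShortExact LinearMap.id g A B C) {r : ℤ} (hB : RegLE n B (r + 1))
    (hC : RegLE (n + 1) C r) : RegLE n A (r + 1) := by
  obtain ⟨ι, _, s, z, hs, hz, hC⟩ := hC
  cases n with
  | zero => trivial
  | succ n =>
    choose b hb hbz using fun l => h.surj (hz.mem l)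
    have hgb : ∀ q : ι → R, g (Fintype.linearCombination R b q) =
        Fintype.linearCombination R z q := by
      intro q
      simp [Fintype.linearCombination_apply, map_sum, hbz]
    have hA : ∀ {d y}, y ∈ A.piece d ↔ y ∈ B.piece d ∧ g y = 0 := by
      intro d y
      refine ⟨fun hy => ⟨h.map_left hy, h.comp hy⟩, fun hy => ?_⟩
      obtain ⟨x, hx, rfl⟩ := h.exact hy.1 hy.2
      exact hx
    have hP : RegLE (n + 1) (A.prod (GradedFamily.free 𝒜 s)) (r + 1) := by
      refine middle (f := LinearMap.prod (-Fintype.linearCombination R b) LinearMap.id)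
        (g := LinearMap.coprod LinearMap.id (Fintype.linearCombination R b)) ?_ hC hB
      refine ⟨?_, ?_, ?_, ?_, ?_, ?_⟩
      · intro d q hq
        refine ⟨hA.2 ⟨neg_mem (B.linearCombination_mem hb hq.1), ?_⟩, hq.1⟩
        change g (-Fintype.linearCombination R b q) = 0
        rw [map_neg, hgb, (mem_ker.1 hq).2, neg_zero]
      · intro d q _ hq
        exact congrArg Prod.snd hq
      · intro d q _
        simp
      · rintro d ⟨y, q⟩ hp h0
        simp only [LinearMap.coprod_apply, LinearMap.id_apply] at h0
        have hy : y = -Fintype.linearCombination R b q := eq_neg_of_add_eq_zero_left h0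
        refine ⟨q, ⟨hp.2, ?_⟩, ?_⟩
        · have h1 := congrArg g h0
          rw [map_add, (hA.1 hp.1).2, zero_add, hgb, map_zero] at h1
          exact h1
        · simp [hy]
      · rintro d ⟨y, q⟩ hp
        exact add_mem (hA.1 hp.1).1 (B.linearCombination_mem hb hp.2)
      · intro d y hy
        obtain ⟨q, hq, hqy⟩ := hz.surj (h.map_right hy)
        refine ⟨(y - Fintype.linearCombination R b q, q),
          ⟨hA.2 ⟨sub_mem hy (B.linearCombination_mem hb hq), ?_⟩, hq⟩, ?_⟩
        · rw [map_sub, hgb, hqy, sub_self]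
        · simp
    refine right (g := LinearMap.fst R Y (ι → R))
      (A := (GradedFamily.zero 𝒜 Y).prod (GradedFamily.free 𝒜 s)) ?_ ?_ hP
    · refine ⟨?_, fun _ h0 => h0, fun hp => mem_zero.1 hp.1, ?_, fun hp => hp.1,
        fun {d y} hy => ⟨(y, 0), ⟨hy, zero_mem _⟩, rfl⟩⟩
      · rintro d ⟨y, q⟩ ⟨hy, hq⟩
        obtain rfl : y = 0 := hy
        exact ⟨zero_mem _, hq⟩
      · rintro d ⟨y, q⟩ hp h0
        exact ⟨(y, q), ⟨mem_zero.2 h0, hp.2⟩, rfl⟩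
    · refine middle (f := LinearMap.inr R Y (ι → R)) (g := LinearMap.fst R Y (ι → R))
        (C := GradedFamily.zero 𝒜 Y) ?_ (free (fun l => (hs l).trans (by omega)) n)
        (of_eq_zero mem_zero.1)
      refine ⟨fun hq => ⟨zero_mem _, hq⟩, fun _ h0 => congrArg Prod.snd h0, fun _ => rfl, ?_,
        fun hp => hp.1, fun {d y} hy => ⟨(y, 0), ⟨hy, zero_mem _⟩, rfl⟩⟩
      rintro d ⟨y, q⟩ hp h0
      obtain rfl : y = 0 := h0
      exact ⟨q, hp.2, rfl⟩

theorem syz {ι : Type} [Fintype ι] {n : ℕ} {A : GradedFamily 𝒜 X} {s : ι → ℤ} {x : ι → X}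
    (hx : A.IsCover s x) {r : ℤ} (hs : ∀ l, s l ≤ r) (hA : RegLE (n + 1) A r) :
    RegLE n (syz 𝒜 s x) (r + 1) :=
  left (shortExact_ker (fun hf => A.linearCombination_mem hx.mem hf) hx.surj)
    (free (fun l => by have := hs l; omega) n) hA

end RegLE

namespace GradedFamily

variable {ι : Type*}

/-- The component of degree `d` of a vector in the graded free module `⊕_v R(-s_v)`. -/
def homogPart (𝒜 : ℤ → Submodule K R) [GradedAlgebra 𝒜] (s : ι → ℤ) (d : ℤ)
    (f : ι → R) : ι → R :=
  fun v => GradedRing.proj 𝒜 (d - s v) (f v)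

theorem proj_of_mem {d : ℤ} {r : R} (h : r ∈ 𝒜 d) : GradedRing.proj 𝒜 d r = r := by
  rw [GradedRing.proj_apply, DirectSum.decompose_of_mem_same 𝒜 h]

theorem homogPart_mem (s : ι → ℤ) (d : ℤ) (f : ι → R) :
    homogPart 𝒜 s d f ∈ (free 𝒜 s).piece d :=
  fun _ => SetLike.coe_mem _

theorem homogPart_of_mem {s : ι → ℤ} {d : ℤ} {f : ι → R} (hf : f ∈ (free 𝒜 s).piece d) :
    homogPart 𝒜 s d f = f :=
  funext fun v => proj_of_mem (hf v)

variable [Fintype ι]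

theorem proj_linearCombination {s : ι → ℤ} {x : ι → R} (hx : ∀ l, x l ∈ 𝒜 (s l)) (d : ℤ)
    (f : ι → R) : GradedRing.proj 𝒜 d (Fintype.linearCombination R x f) =
      Fintype.linearCombination R x (homogPart 𝒜 s d f) := by
  simp only [Fintype.linearCombination_apply, map_sum, smul_eq_mul]
  refine Finset.sum_congr rfl fun l _ => ?_
  have := DirectSum.coe_decompose_mul_add_of_right_mem 𝒜 (i := d - s l) (a := f l) (hx l)
  rwa [sub_add_cancel] at this

theorem homogPart_linearCombination {κ : Type*} {s : ι → ℤ} {t : κ → ℤ} {x : ι → κ → R}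
    (hx : ∀ l, x l ∈ (free 𝒜 t).piece (s l)) (d : ℤ) (f : ι → R) :
    homogPart 𝒜 t d (Fintype.linearCombination R x f) =
      Fintype.linearCombination R x (homogPart 𝒜 s d f) := by
  funext v
  have h := proj_linearCombination (x := fun l => x l v) (fun l => hx l v) (d - t v) f
  have hs : homogPart 𝒜 (fun l => s l - t v) (d - t v) f = homogPart 𝒜 s d f := by
    funext l
    simp only [homogPart, sub_sub_sub_cancel_right]
  rw [hs] at h
  simpa [homogPart, Fintype.linearCombination_apply, Finset.sum_apply] using h

theorem exists_sum_homogPart (s : ι → ℤ) (f : ι → R) :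
    ∃ S : Finset ℤ, f = ∑ d ∈ S, homogPart 𝒜 s d f := by
  classical
  refine ⟨Finset.univ.biUnion fun v =>
    ((DirectSum.decompose 𝒜 (f v)).support).map (addRightEmbedding (s v)), funext fun v => ?_⟩
  rw [Finset.sum_apply]
  refine (DirectSum.sum_support_decompose 𝒜 (f v)).symm.trans ?_
  have h := Finset.sum_map (DirectSum.decompose 𝒜 (f v)).support (addRightEmbedding (s v))
    fun d => homogPart 𝒜 s d f v
  simp only [homogPart, GradedRing.proj_apply, addRightEmbedding_apply, add_sub_cancel_right] at h
  rw [← h]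
  refine Finset.sum_subset 
    (fun d hd => Finset.mem_biUnion.2 ⟨v, Finset.mem_univ v, hd⟩) fun d _ hd => ?_
  by_contra h0
  refine hd (Finset.mem_map.2 ⟨d - s v, ?_, sub_add_cancel d (s v)⟩)
  rw [DFinsupp.mem_support_toFun]
  exact fun h1 => h0 (by rw [h1]; rfl)

theorem isCover_range {κ : Type*} {s : ι → ℤ} {t : κ → ℤ} {x : ι → κ → R}
    (hx : ∀ l, x l ∈ (free 𝒜 t).piece (s l)) :
    ((free 𝒜 t).inter (LinearMap.range (Fintype.linearCombination R x))).IsCover s x where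
  mem l := by
    classical
    exact ⟨hx l, Pi.single l 1, by rw [Fintype.linearCombination_apply_single, one_smul]⟩
  surj := by
    rintro d y ⟨hy, f, rfl⟩
    exact ⟨_, homogPart_mem s d f,
      (homogPart_linearCombination hx d f).symm.trans (homogPart_of_mem hy)⟩

end GradedFamily

theorem GRes.regLE_range {M : Type*} [AddCommGroup M] [Module R M] [Module K M]
    [IsScalarTower K R M] {ℳ : ℤ → Submodule K M} {N : Submodule R M} (res : GRes 𝒜 ℳ N)
    {r : ℤ} (hr : ∀ i l, res.sh i l ≤ (i : ℤ) + r) (n i : ℕ) :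
    RegLE n ((free 𝒜 (res.sh i)).inter (LinearMap.range (res.diff i))) (i + r + 1) := by
  induction n generalizing i with
  | zero => trivial
  | succ n ih =>
    have hcover := isCover_range (t := res.sh i) (res.diff_hom i)
    rw [linearCombination_single] at hcover
    refine ⟨_, inferInstance, _, _, fun l => ?_, hcover, ?_⟩
    · have := hr (i + 1) l
      push_cast at this
      linarith
    · have := ih (i + 1)
      rw [res.exs] at this
      rw [syz, linearCombination_single]
      convert this using 1
      push_cast
      ring

theorem GRes.regLE {k : ℕ} {s : Fin k → ℤ} {N : Submodule R (Fin k → R)}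
    (res : GRes 𝒜 (freeGrade 𝒜 s) N) {r : ℤ} (hr : ∀ i l, res.sh i l ≤ (i : ℤ) + r) (n : ℕ) :
    RegLE n ((free 𝒜 s).inter N) r := by
  cases n with
  | zero => trivial
  | succ n =>
    have hcover := isCover_range (t := s) res.aug_hom
    rw [linearCombination_single, res.aug_range] at hcover
    refine ⟨_, inferInstance, _, _, fun l => by simpa using hr 0 l, hcover, ?_⟩
    have := res.regLE_range hr n 0
    rw [res.ex0] at this
    rw [syz, linearCombination_single]
    simpa using this

namespace RegLE

variable {hneg : ∀ i : ℤ, i < 0 → 𝒜 i = ⊥}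

theorem trunc_supported {ι : Type} [Fintype ι] {n : ℕ} {s : ι → ℤ} {a r : ℤ} (T : Finset ι)
    (h : ∀ l ∈ T, RegLE n (((self 𝒜).shift (s l)).trunc hneg a) r) :
    RegLE n (((GradedFamily.free 𝒜 s).supported (T : Set ι)).trunc hneg a) r := by
  classical
  induction T using Finset.induction_on with
  | empty => exact of_eq_zero fun {d f} hf => funext fun v => hf.1.2 v (by simp)
  | insert l T hl ih =>
    refine middle (f := LinearMap.id) (g := LinearMap.proj l) (ShortExact.trunc ?_ hneg a)
      (ih fun v hv => h v (Finset.mem_insert_of_mem hv)) (h l (Finset.mem_insert_self l T))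
    refine ⟨?_, fun _ h0 => h0, fun {d f} hf => hf.2 l (by simpa using hl), ?_,
      fun hf => hf.1 l, fun {d z} hz => ⟨Pi.single l z, ⟨fun v => ?_, fun v hv => ?_⟩, by simp⟩⟩
    · intro d f hf
      exact ⟨hf.1, fun v hv => hf.2 v fun hv' => hv (by simp at hv' ⊢; exact Or.inr hv')⟩
    · intro d f hf h0
      refine ⟨f, ⟨hf.1, fun v hv => ?_⟩, rfl⟩
      rcases eq_or_ne v l with rfl | hvl
      · exact h0
      · exact hf.2 v (by simp at hv ⊢; exact ⟨hvl, hv⟩)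
    · rcases eq_or_ne v l with rfl | hvl
      · rw [Pi.single_eq_same]
        exact hz
      · rw [Pi.single_eq_of_ne hvl]
        exact zero_mem _
    · rw [Pi.single_eq_of_ne]
      rintro rfl
      exact hv (by simp)

theorem trunc_self_shift {n : ℕ} (h : ∀ t : ℕ, RegLE n ((self 𝒜).trunc hneg t) t) {s a r : ℤ}
    (hs : s ≤ r) (ha : a ≤ r) : RegLE n (((self 𝒜).shift s).trunc hneg a) r := by
  rcases le_total a s with has | has
  · have heq : ((self 𝒜).shift s).trunc hneg a = ((self 𝒜).trunc hneg (0 : ℕ)).shift s := by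
      ext d x
      rw [mem_trunc, mem_shift, mem_shift, mem_trunc]
      refine and_congr_right fun hx => ?_
      have : ∀ {p : Prop}, (p → d < s) → (p → x = 0) := fun hp h0 => by
        have h1 := hneg (d - s) (by have := hp h0; omega)
        rw [mem_self, h1] at hx
        exact hx
      exact ⟨fun _ => this (by simp), fun _ => this (by omega)⟩
    rw [heq]
    exact ((h 0).shift s).mono (by simpa using hs)
  · obtain ⟨t, ht⟩ := Int.eq_ofNat_of_zero_le (sub_nonneg.2 has)
    obtain rfl : a = t + s := by omega
    rw [← shift_trunc]
    exact ((h t).shift s).mono ha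

theorem trunc {n : ℕ} (h : ∀ t : ℕ, RegLE n ((self 𝒜).trunc hneg t) t)
    {X : Type u} [AddCommGroup X] [Module R X] {A : GradedFamily 𝒜 X} {r : ℤ}
    (hA : RegLE n A r) (a : ℤ) : RegLE n (A.trunc hneg a) (max r a) := by
  induction n generalizing X r with
  | zero => trivial
  | succ n ih =>
    obtain ⟨ι, _, s, x, hs, hx, hA⟩ := hA
    refine right (ShortExact.trunc
      (shortExact_ker (fun hf => A.linearCombination_mem hx.mem hf) hx.surj) hneg a)
      ((ih (fun t => (h t).of_succ) hA).mono (by omega)) ?_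
    have := trunc_supported (s := s) (hneg := hneg) Finset.univ fun l _ =>
      trunc_self_shift h ((hs l).trans (le_max_left r a)) (le_max_right r a)
    convert this using 2
    ext d f
    simp [mem_supported]

end RegLE

theorem Koszul.regLE_self_trunc (hstd : IsStdGraded 𝒜) (hkos : Koszul 𝒜) (n t : ℕ) :
    RegLE n ((self 𝒜).trunc hstd.1 t) t := by
  induction n generalizing t with
  | zero => trivial
  | succ n ih =>
    induction t with
    | zero =>
      have hlin : ∀ f : Unit → R, Fintype.linearCombination R (fun _ : Unit => (1 : R)) f = f () := by
        intro f
        simp [Fintype.linearCombination_apply]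
      refine ⟨Unit, inferInstance, fun _ => 0, fun _ => 1, fun _ => le_rfl,
        ⟨fun _ => ⟨(SetLike.GradedOne.one_mem : (1 : R) ∈ 𝒜 0), fun h => absurd h (lt_irrefl 0)⟩, ?_⟩,
        RegLE.of_eq_zero fun {d f} hf => funext fun _ => (hlin f).symm.trans hf.2⟩
      intro d y hy
      refine ⟨fun _ => y, fun _ => ?_, hlin _⟩
      rw [sub_zero]
      exact hy.1
    | succ t iht =>
      obtain ⟨res, -, hsh⟩ := hkos
      have hx : ∀ l, res.aug (Pi.single l 1) ∈ 𝒜 1 := by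
        intro l
        have := res.aug_hom l
        rwa [hsh, Nat.cast_zero, zero_add] at this
      have hcover : ((self 𝒜).trunc hstd.1 1).IsCover (fun _ => 1)
          fun l => res.aug (Pi.single l 1) := by
        refine ⟨fun l => ⟨hx l, fun h => absurd h (lt_irrefl 1)⟩, fun {d y} hy => ?_⟩
        rcases lt_or_ge d 1 with hd | hd
        · exact ⟨0, zero_mem _, by rw [map_zero, hy.2 hd]⟩
        · have hmem : y ∈ mIdealG 𝒜 := Ideal.subset_span
            (Set.mem_iUnion.2 ⟨⟨d, by omega⟩, hy.1⟩)
          rw [← res.aug_range] at hmem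
          obtain ⟨f, rfl⟩ := hmem
          refine ⟨_, homogPart_mem _ d f, ?_⟩
          rw [← proj_linearCombination hx, linearCombination_single]
          exact proj_of_mem hy.1
      have hsyz : RegLE n (syz 𝒜 (fun _ => 1) fun l => res.aug (Pi.single l 1)) (1 + 1) := by
        have h := res.regLE_range (r := 1) (fun i l => (hsh i l).le) n 0
        have hsh0 : res.sh 0 = fun _ => 1 := funext fun l => by rw [hsh]; simp
        rw [res.ex0, hsh0] at h
        rw [syz, linearCombination_single]
        simpa using h
      have hself : (self 𝒜).trunc hstd.1 (t + 1 : ℕ) =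
          ((self 𝒜).trunc hstd.1 1).trunc hstd.1 (t + 1 : ℕ) := by
        ext d x
        simp only [mem_trunc]
        exact ⟨fun h => ⟨⟨h.1, fun hd => h.2 (by omega)⟩, h.2⟩, fun h => ⟨h.1.1, h.2⟩⟩
      rw [hself]
      refine RegLE.right (ShortExact.trunc (shortExact_ker
        (fun hf => linearCombination_mem _ hcover.mem hf) hcover.surj) hstd.1 _)
        ((RegLE.trunc ih hsyz _).mono (by omega)) ?_
      have := RegLE.trunc_supported (s := fun _ : Fin (res.rk 0) => 1) (hneg := hstd.1)
        (n := n + 1) (a := (t + 1 : ℕ)) (r := (t + 1 : ℕ)) Finset.univ fun l _ => by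
          push_cast
          rw [← shift_trunc]
          exact iht.shift 1
      convert this using 2
      ext d f
      simp [mem_supported]

theorem eq_zero_of_mem_mIdealG (hneg : ∀ i : ℤ, i < 0 → 𝒜 i = ⊥) {i : ℤ} {r : R} (hi : i ≤ 0)
    (hr : r ∈ 𝒜 i) (hm : r ∈ mIdealG 𝒜) : r = 0 := by
  rcases hi.lt_or_eq with hi | rfl
  · rwa [hneg i hi, Submodule.mem_bot] at hr
  · obtain ⟨k, f, g, rfl⟩ := Submodule.mem_span_set'.1 hm
    have hg : ∀ l, ∃ j : ℤ, j ≠ 0 ∧ (g l : R) ∈ 𝒜 j := fun l => by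
      obtain ⟨⟨j, hj⟩, h⟩ := Set.mem_iUnion.1 (g l).2
      exact ⟨j, hj, h⟩
    choose s hs hgs using hg
    have h0 := proj_linearCombination hgs 0 f
    rw [Fintype.linearCombination_apply, proj_of_mem hr] at h0
    rw [h0, Fintype.linearCombination_apply]
    refine Finset.sum_eq_zero fun l _ => ?_
    rcases (hs l).lt_or_gt with hl | hl
    · have := hgs l
      rw [hneg _ hl, Submodule.mem_bot] at this
      rw [this, smul_zero]
    · have := homogPart_mem (𝒜 := 𝒜) s 0 f l
      rw [hneg _ (by omega), Submodule.mem_bot] at this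
      rw [this, zero_smul]

namespace RegLE

variable {X : Type u} [AddCommGroup X] [Module R X]

theorem exists_fin_cover {A : GradedFamily 𝒜 X} {r : ℤ} (h : RegLE 1 A r) :
    ∃ (k : ℕ) (s : Fin k → ℤ) (x : Fin k → X), (∀ l, s l ≤ r) ∧ A.IsCover s x := by
  obtain ⟨ι, _, s, x, hs, hx, -⟩ := h
  let e := Fintype.equivFin ι
  refine ⟨_, s ∘ e.symm, x ∘ e.symm, fun l => hs _, fun l => hx.mem _, fun {d y} hy => ?_⟩
  obtain ⟨f, hf, rfl⟩ := hx.surj hy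
  refine ⟨f ∘ e.symm, fun l => hf _, ?_⟩
  simp only [Fintype.linearCombination_apply, Function.comp_apply]
  exact e.symm.sum_comp fun l => f l • x l

theorem exists_minimal_cover (hstd : IsStdGraded 𝒜) {A : GradedFamily 𝒜 X} {r : ℤ}
    (h : RegLE 1 A r) :
    ∃ (k : ℕ) (s : Fin k → ℤ) (x : Fin k → X), (∀ l, s l ≤ r) ∧ A.IsCover s x ∧
      ∀ d, ∀ f ∈ (GradedFamily.syz 𝒜 s x).piece d, ∀ v, f v ∈ mIdealG 𝒜 := by
  classical
  have hex := h.exists_fin_cover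
  obtain ⟨s, x, hs, hx⟩ := Nat.find_spec hex
  have hmin := fun k => Nat.find_min (m := k) hex
  generalize Nat.find hex = k at s x hs hx hmin
  refine ⟨k, s, x, hs, hx, fun d f hf l => ?_⟩
  by_contra hfl
  have hd : d - s l = 0 := by
    by_contra hne
    exact hfl (Ideal.subset_span (Set.mem_iUnion.2 ⟨⟨_, hne⟩, hf.1 l⟩))
  have hfl0 : f l ∈ (1 : Submodule K R) := by
    rw [← hstd.2.1, ← hd]
    exact hf.1 l
  obtain ⟨c, hc⟩ := Submodule.mem_one.1 hfl0
  have hc0 : c ≠ 0 := by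
    rintro rfl
    rw [map_zero] at hc
    exact hfl (hc ▸ zero_mem _)
  obtain _ | k := k
  · exact l.elim0
  refine hmin k k.lt_succ_self ⟨s ∘ l.succAbove, x ∘ l.succAbove, fun v => hs _, fun v => hx.mem _,
    fun {e y} hy => ?_⟩
  obtain ⟨g, hg, rfl⟩ := hx.surj hy
  have hgf : ((c⁻¹ • g l) • f) ∈ (GradedFamily.free 𝒜 s).piece e :=
    GradedFamily.smul_mem _ ((𝒜 _).smul_mem c⁻¹ (hg l)) hf.1 (by omega)
  have h0 : (g - (c⁻¹ • g l) • f) l = 0 := by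
    rw [Pi.sub_apply, Pi.smul_apply, ← hc, smul_eq_mul, mul_comm, ← Algebra.smul_def,
      smul_inv_smul₀ hc0, sub_self]
  refine ⟨(g - (c⁻¹ • g l) • f) ∘ l.succAbove, fun v => sub_mem hg hgf _, ?_⟩
  have hsum : Fintype.linearCombination R x (g - (c⁻¹ • g l) • f) =
      Fintype.linearCombination R x g := by
    rw [map_sub, map_smul, (mem_ker.1 hf).2, smul_zero, sub_zero]
  rw [← hsum, Fintype.linearCombination_apply, Fintype.linearCombination_apply,
    Fin.sum_univ_succAbove _ l, h0, zero_smul, zero_add]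
  rfl

end RegLE

/-- A graded family inside a graded free module with regularity at most `r`, seen as a stage of
the construction of a minimal graded free resolution. -/
structure ResolutionStage (𝒜 : ℤ → Submodule K R) [GradedAlgebra 𝒜] where
  rk : ℕ
  sh : Fin rk → ℤ
  fam : GradedFamily 𝒜 (Fin rk → R)
  le_free : ∀ {d f}, f ∈ fam.piece d → f ∈ (free 𝒜 sh).piece d
  reg : ℤ
  regLE : ∀ n, RegLE n fam reg

namespace ResolutionStage

variable (hstd : IsStdGraded 𝒜) (S : ResolutionStage 𝒜)

/-- The stage of the syzygies of a minimal cover. -/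
noncomputable def next : ResolutionStage 𝒜 where
  rk := ((S.regLE 1).exists_minimal_cover hstd).choose
  sh := ((S.regLE 1).exists_minimal_cover hstd).choose_spec.choose
  fam := syz 𝒜 ((S.regLE 1).exists_minimal_cover hstd).choose_spec.choose
    ((S.regLE 1).exists_minimal_cover hstd).choose_spec.choose_spec.choose
  le_free hf := hf.1
  reg := S.reg + 1
  regLE n := RegLE.syz
    ((S.regLE 1).exists_minimal_cover hstd).choose_spec.choose_spec.choose_spec.2.1
    ((S.regLE 1).exists_minimal_cover hstd).choose_spec.choose_spec.choose_spec.1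
    (S.regLE (n + 1))

/-- The generators of a minimal cover. -/
noncomputable def gen : Fin (S.next hstd).rk → Fin S.rk → R :=
  ((S.regLE 1).exists_minimal_cover hstd).choose_spec.choose_spec.choose

theorem isCover_gen : S.fam.IsCover (S.next hstd).sh (S.gen hstd) :=
  ((S.regLE 1).exists_minimal_cover hstd).choose_spec.choose_spec.choose_spec.2.1

theorem next_sh_le (l : Fin (S.next hstd).rk) : (S.next hstd).sh l ≤ S.reg :=
  ((S.regLE 1).exists_minimal_cover hstd).choose_spec.choose_spec.choose_spec.1 l

theorem mem_next_fam {d : ℤ} {f : Fin (S.next hstd).rk → R} :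
    f ∈ (S.next hstd).fam.piece d ↔ f ∈ (free 𝒜 (S.next hstd).sh).piece d ∧
      Fintype.linearCombination R (S.gen hstd) f = 0 := Iff.rfl

theorem mem_mIdealG {d : ℤ} {f : Fin (S.next hstd).rk → R}
    (hf : f ∈ (S.next hstd).fam.piece d) (v) : f v ∈ mIdealG 𝒜 :=
  ((S.regLE 1).exists_minimal_cover hstd).choose_spec.choose_spec.choose_spec.2.2 d f hf v

theorem linearCombination_gen_single_mem (l : Fin (S.next hstd).rk) :
    Fintype.linearCombination R (S.gen hstd) (Pi.single l 1) ∈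
      (free 𝒜 S.sh).piece ((S.next hstd).sh l) := by
  rw [Fintype.linearCombination_apply_single, one_smul]
  exact S.le_free ((S.isCover_gen hstd).mem l)

theorem range_gen : LinearMap.range (Fintype.linearCombination R (S.gen hstd)) =
    Submodule.span R (⋃ d, (S.fam.piece d : Set (Fin S.rk → R))) := by
  rw [Fintype.range_linearCombination]
  refine le_antisymm (Submodule.span_mono ?_) (Submodule.span_le.2 ?_)
  · rintro _ ⟨l, rfl⟩
    exact Set.mem_iUnion.2 ⟨_, (S.isCover_gen hstd).mem l⟩
  · intro y hy
    obtain ⟨d, hd⟩ := Set.mem_iUnion.1 hy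
    obtain ⟨f, -, rfl⟩ := (S.isCover_gen hstd).surj hd
    rw [← Fintype.range_linearCombination]
    exact ⟨f, rfl⟩

theorem ker_gen : LinearMap.ker (Fintype.linearCombination R (S.gen hstd)) =
    Submodule.span R (⋃ d, ((S.next hstd).fam.piece d : Set (Fin (S.next hstd).rk → R))) := by
  refine le_antisymm (fun f hf => ?_) (Submodule.span_le.2 ?_)
  · obtain ⟨T, hT⟩ := exists_sum_homogPart (𝒜 := 𝒜) (S.next hstd).sh f
    rw [hT]
    refine sum_mem fun d _ => Submodule.subset_span (Set.mem_iUnion.2 ⟨d, ?_⟩)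
    refine (S.mem_next_fam hstd).2 ⟨homogPart_mem _ d f, ?_⟩
    rw [← homogPart_linearCombination (t := S.sh)
      (fun l => S.le_free ((S.isCover_gen hstd).mem l)), LinearMap.mem_ker.1 hf]
    exact homogPart_of_mem (zero_mem _)
  · intro f hf
    obtain ⟨d, hd⟩ := Set.mem_iUnion.1 hf
    exact ((S.mem_next_fam hstd).1 hd).2

/-- The iterated stages. -/
noncomputable def iter : ℕ → ResolutionStage 𝒜
  | 0 => S
  | i + 1 => (iter i).next hstd

theorem iter_reg (i : ℕ) : (S.iter hstd i).reg = i + S.reg := by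
  induction i with
  | zero => simp [iter]
  | succ i ih =>
    change (S.iter hstd i).reg + 1 = _
    rw [ih]
    push_cast
    ring

/-- The minimal graded free resolution obtained by iterating minimal covers. -/
noncomputable def resolution : GRes 𝒜 (freeGrade 𝒜 S.sh)
    (Submodule.span R (⋃ d, (S.fam.piece d : Set (Fin S.rk → R)))) where
  rk i := (S.iter hstd (i + 1)).rk
  sh i := (S.iter hstd (i + 1)).sh
  aug := Fintype.linearCombination R (S.gen hstd)
  diff i := Fintype.linearCombination R ((S.iter hstd (i + 1)).gen hstd)
  aug_range := S.range_gen hstd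
  aug_hom := S.linearCombination_gen_single_mem hstd
  diff_hom i := (S.iter hstd (i + 1)).linearCombination_gen_single_mem hstd
  ex0 := ((S.iter hstd 1).range_gen hstd).trans (S.ker_gen hstd).symm
  exs i := ((S.iter hstd (i + 2)).range_gen hstd).trans
    ((S.iter hstd (i + 1)).ker_gen hstd).symm

theorem resolution_minimal : (S.resolution hstd).Minimal := by
  intro i f v
  have hf : (S.resolution hstd).diff i f ∈
      LinearMap.range (Fintype.linearCombination R ((S.iter hstd (i + 1)).gen hstd)) := ⟨f, rfl⟩
  rw [range_gen] at hf
  have hle : Submodule.span R (⋃ d, ((S.iter hstd (i + 1)).fam.piece d :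
      Set (Fin (S.iter hstd (i + 1)).rk → R))) ≤
        Submodule.comap (LinearMap.proj v) (mIdealG 𝒜) := by
    refine Submodule.span_le.2 fun y hy => ?_
    obtain ⟨d, hd⟩ := Set.mem_iUnion.1 hy
    exact (S.iter hstd i).mem_mIdealG hstd hd v
  exact hle hf

end ResolutionStage

theorem RegLE.gRegLE_span (hstd : IsStdGraded 𝒜) {k : ℕ} {s : Fin k → ℤ}
    {A : GradedFamily 𝒜 (Fin k → R)}
    (hA : ∀ {d f}, f ∈ A.piece d → f ∈ (GradedFamily.free 𝒜 s).piece d) {r : ℤ}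
    (h : ∀ n, RegLE n A r) :
    GRegLE 𝒜 (freeGrade 𝒜 s)
      (Submodule.span R (⋃ d, (A.piece d : Set (Fin k → R)))) r := by
  let S : ResolutionStage 𝒜 := ⟨k, s, A, hA, r, h⟩
  refine ⟨S.resolution hstd, S.resolution_minimal hstd, fun i l => ?_⟩
  exact ((S.iter hstd i).next_sh_le hstd l).trans (S.iter_reg hstd i).le

theorem GCompLinear.ker (hstd : IsStdGraded 𝒜) (hkos : Koszul 𝒜) {k m : ℕ} {s : Fin m → ℤ}
    {t : Fin k → ℤ} {φ : (Fin m → R) →ₗ[R] (Fin k → R)}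
    (hφ : ∀ l, φ (Pi.single l 1) ∈ (free 𝒜 t).piece (s l))
    (hmin : ∀ f ∈ LinearMap.ker φ, ∀ v, f v ∈ mIdealG 𝒜)
    (h : GCompLinear 𝒜 t (LinearMap.range φ)) : GCompLinear 𝒜 s (LinearMap.ker φ) := by
  intro a
  right
  have hhom : ∀ d f, φ (homogPart 𝒜 s d f) = homogPart 𝒜 t d (φ f) := by
    intro d f
    have := homogPart_linearCombination hφ d f
    rwa [linearCombination_single, eq_comm] at this
  set N : Submodule R (Fin k → R) := Submodule.span R
    ((freeGrade 𝒜 t (a - 1) : Set (Fin k → R)) ∩ LinearMap.range φ) with hN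
  have hregN : ∀ n, RegLE n ((free 𝒜 t).inter N) (a - 1) := by
    intro n
    rcases h (a - 1) with h0 | ⟨res, -, hsh⟩
    · refine RegLE.of_eq_zero fun {d y} hy => ?_
      have := hy.2
      rw [hN, h0] at this
      exact this
    · exact res.regLE hsh n
  let T : Finset (Fin m) := {l | s l ≤ a - 1}
  let H := ((free 𝒜 s).supported (T : Set (Fin m))).trunc hstd.1 (a - 1)
  have hregH : ∀ n, RegLE n H (a - 1) := fun n => RegLE.trunc_supported T fun l hl =>
    RegLE.trunc_self_shift (hkos.regLE_self_trunc hstd n) (Finset.mem_filter.1 hl).2 le_rfl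
  have hses : ShortExact LinearMap.id φ (H.ker φ) H ((free 𝒜 t).inter N) := by
    refine shortExact_ker ?_ ?_
    · intro d f hf
      rw [← linearCombination_single φ]
      refine ⟨linearCombination_mem _ hφ hf.1.1, ?_⟩
      rcases lt_or_ge d (a - 1) with hd | hd
      · rw [hf.2 hd, map_zero]
        exact N.zero_mem
      rw [Fintype.linearCombination_apply]
      refine N.sum_mem fun l _ => ?_
      by_cases hl : s l ≤ a - 1
      · have hfl := hf.1.1 l
        rw [show d - s l = (d - (a - 1)) + (a - 1 - s l) by ring] at hfl
        refine Submodule.mul_induction_on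
          (hstd.mem_mul (sub_nonneg.2 hd) (sub_nonneg.2 hl) hfl) (fun u _ v hv => ?_)
          fun u v hu hv => ?_
        · rw [mul_smul]
          refine N.smul_mem u (Submodule.subset_span ⟨?_, v • Pi.single l 1, map_smul _ _ _⟩)
          exact GradedFamily.smul_mem _ hv (hφ l) (sub_add_cancel _ _)
        · rw [add_smul]
          exact N.add_mem hu hv
      · have : f l = 0 := hf.1.2 l (by simpa [T] using hl)
        rw [this, zero_smul]
        exact N.zero_mem
    · rintro d y ⟨hy, hyN⟩
      obtain ⟨q, f, g, rfl⟩ := Submodule.mem_span_set'.1 hyN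
      have hg : ∀ l, ∃ p ∈ H.piece (a - 1), φ p = g l := by
        intro l
        obtain ⟨hgl, p, hp⟩ := (g l).2
        refine ⟨homogPart 𝒜 s (a - 1) p, ⟨⟨homogPart_mem _ _ _, fun v hv => ?_⟩,
          fun hd => absurd hd (lt_irrefl _)⟩, ?_⟩
        · have h0 := homogPart_mem (𝒜 := 𝒜) s (a - 1) p v
          have hv' : a - 1 < s v := by simpa [T] using hv
          rw [hstd.1 _ (by omega)] at h0
          exact h0
        · rw [hhom, hp]
          exact homogPart_of_mem hgl
      choose p hp hpg using hg
      have hpart := homogPart_linearCombination (s := fun _ => a - 1) (t := t)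
        (x := fun l => (g l : Fin k → R)) (fun l => (g l).2.1) d f
      rw [Fintype.linearCombination_apply, homogPart_of_mem hy] at hpart
      refine ⟨_, H.linearCombination_mem hp (homogPart_mem (fun _ => a - 1) d f), ?_⟩
      rw [hpart, Fintype.linearCombination_apply, Fintype.linearCombination_apply, map_sum]
      simp only [map_smul, hpg]
  have hregW : ∀ n, RegLE n ((H.ker φ).trunc hstd.1 a) a := by
    intro n
    have hW : RegLE n (H.ker φ) (a - 1 + 1) :=
      RegLE.left hses ((hregH n).mono (by omega)) (hregN (n + 1))
    exact (RegLE.trunc (hkos.regLE_self_trunc hstd n) hW a).mono (by simp)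
  have heq : Submodule.span R ((freeGrade 𝒜 s a : Set (Fin m → R)) ∩ LinearMap.ker φ) =
      Submodule.span R (⋃ d, (((H.ker φ).trunc hstd.1 a).piece d : Set (Fin m → R))) := by
    refine le_antisymm (Submodule.span_mono ?_) (Submodule.span_le.2 ?_)
    · rintro f ⟨hf, hfφ⟩
      refine Set.mem_iUnion.2 ⟨a, ⟨⟨⟨⟨hf, fun v hv => ?_⟩, fun hd => absurd hd (by omega)⟩, hfφ⟩,
        fun hd => absurd hd (lt_irrefl a)⟩⟩
      have hv' : a - 1 < s v := by simpa [T] using hv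
      exact eq_zero_of_mem_mIdealG hstd.1 (by omega) (hf v) (hmin f hfφ v)
    · intro f hf
      obtain ⟨d, hd⟩ := Set.mem_iUnion.1 hf
      obtain ⟨ι, _, u, x, hu, hx, -⟩ := hregW 1
      obtain ⟨p, -, rfl⟩ := hx.surj hd
      rw [Fintype.linearCombination_apply]
      refine sum_mem fun l _ => Submodule.smul_mem _ _ ?_
      obtain ⟨⟨hxH, hxφ⟩, hx0⟩ := hx.mem l
      rcases (hu l).lt_or_eq with hl | hl
      · rw [hx0 hl]
        exact zero_mem _
      · rw [hl] at hxH
        exact Submodule.subset_span ⟨hxH.1.1, hxφ⟩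
  rw [heq]
  exact RegLE.gRegLE_span hstd (A := (H.ker φ).trunc hstd.1 a) (fun hf => hf.1.1.1.1) hregW

end Families

/-- **Lemma 5.1, Römer.** Over a Koszul algebra `R`, if the
`i`-th syzygy module `Ω_i^R(M)` (the image of the differential in homological
degree `i` of a minimal graded free resolution of `M`) is componentwise linear,
then `Ω_j^R(M)` is componentwise linear for all `j ≥ i`. -/
theorem syzygy_componentwise_linear_stable
    {K : Type*} [Field K] {R : Type*} [CommRing R] [Algebra K R]
    (𝒜 : ℤ → Submodule K R) [GradedAlgebra 𝒜]
    (hstd : IsStdGraded 𝒜) (hkos : Koszul 𝒜)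
    {M : Type*} [AddCommGroup M] [Module R M] [Module K M] [IsScalarTower K R M]
    [Module.Finite R M]
    (ℳ : ℤ → Submodule K M) (hint : DirectSum.IsInternal ℳ)
    (hcomp : ∀ (i j : ℤ), ∀ r ∈ 𝒜 i, ∀ x ∈ ℳ j, r • x ∈ ℳ (i + j))
    (res : GRes 𝒜 ℳ (⊤ : Submodule R M)) (hres : res.Minimal)
    (i : ℕ) (hi : GCompLinear 𝒜 (res.sh i) (LinearMap.range (res.diff i)))
    (j : ℕ) (hj : i ≤ j) :
    GCompLinear 𝒜 (res.sh j) (LinearMap.range (res.diff j)) := by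
  induction j, hj using Nat.le_induction with
  | base => exact hi
  | succ j _ ih =>
    rw [res.exs j]
    refine GCompLinear.ker hstd hkos (res.diff_hom j) (fun f hf v => ?_) ih
    rw [← res.exs j] at hf
    obtain ⟨g, rfl⟩ := hf
    exact hres (j + 1) g v

end CregPaperG
end

section
/- Crystallization: Let M ⊆ F be a finitely generated graded A-module generated in degrees ≤ a. If the initial module in_{(ω,ε)}(M) has no minimal generators in degrees a+1, …, a+1+creg(in_{(ω,ε)}(M)), then in_{(ω,ε)}(M) is generated in degrees ≤ a. -/
/-!  Basic setup: the polynomial ring `A = K[X_1,…,X_n]`, a graded free module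
`F = ⊕_{j} A(-d_j)` realized as `Fin k → A`, weight orders `(ω, ε)`, initial
modules, Hilbert functions, graded free resolutions, Betti numbers,
regularity and componentwise notions, following Caviglia–Varbaro,
"Componentwise regularity (I)". -/

namespace CregPaper

abbrev A (K : Type*) [Field K] (n : ℕ) := MvPolynomial (Fin n) K

variable {K : Type*} [Field K] {n k : ℕ}

/-- `(ω)`-weight of an exponent vector `u`. -/
def wdeg (ω : Fin n → ℕ) (u : Fin n →₀ ℕ) : ℕ := u.sum fun i e => ω i * e

/-- total (standard) degree of an exponent vector `u`. -/
def tdeg (u : Fin n →₀ ℕ) : ℕ := u.sum fun _ e => e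

/-- largest `(ω,ε)`-weight of a monomial in the support of `f ∈ F`. -/
noncomputable def maxWt (ω : Fin n → ℕ) (ε : Fin k → ℕ) (f : Fin k → A K n) : ℕ :=
  Finset.univ.sup fun j => (f j).support.sup fun u => wdeg ω u + ε j

/-- the initial part `in_{(ω,ε)}(f)`: the sum of the terms of `f` of largest weight. -/
noncomputable def inForm (ω : Fin n → ℕ) (ε : Fin k → ℕ) (f : Fin k → A K n) :
    Fin k → A K n :=
  fun j => ∑ u ∈ (f j).support.filter fun u => wdeg ω u + ε j = maxWt ω ε f,
    MvPolynomial.monomial u ((f j).coeff u)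

/-- the initial module `in_{(ω,ε)}(M)`. -/
noncomputable def inMod (ω : Fin n → ℕ) (ε : Fin k → ℕ)
    (M : Submodule (A K n) (Fin k → A K n)) : Submodule (A K n) (Fin k → A K n) :=
  Submodule.span (A K n) {g | ∃ f ∈ M, f ≠ 0 ∧ g = inForm ω ε f}

/-- `f ∈ F = ⊕_j A(-d_j)` is homogeneous of (standard) degree `a`. -/
def IsHomog (d : Fin k → ℕ) (a : ℕ) (f : Fin k → A K n) : Prop :=
  ∀ j, ∀ u ∈ (f j).support, tdeg u + d j = a

/-- the `K`-subspace of `F` of homogeneous elements of degree `a`. -/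
noncomputable def homogSub (d : Fin k → ℕ) (a : ℕ) : Submodule K (Fin k → A K n) where
  carrier := {f | IsHomog d a f}
  add_mem' := by
    intro f g hf hg j u hu
    rcases Finset.mem_union.mp (MvPolynomial.support_add hu) with h | h
    · exact hf j u h
    · exact hg j u h
  zero_mem' := by intro j u hu; simp at hu
  smul_mem' := by
    intro c f hf j u hu
    exact hf j u (MvPolynomial.support_smul hu)

/-- the degree-`a` homogeneous component of `f ∈ F`. -/
noncomputable def homogComp (d : Fin k → ℕ) (f : Fin k → A K n) (a : ℕ) : Fin k → A K n :=
  fun j => ∑ u ∈ (f j).support.filter fun u => tdeg u + d j = a,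
    MvPolynomial.monomial u ((f j).coeff u)

/-- `M ⊆ F` is a graded submodule. -/
def IsGradedSub (d : Fin k → ℕ) (M : Submodule (A K n) (Fin k → A K n)) : Prop :=
  ∀ f ∈ M, ∀ a, homogComp d f a ∈ M

/-- Hilbert function of `M ⊆ F` in degree `a`. -/
noncomputable def hilb (d : Fin k → ℕ) (M : Submodule (A K n) (Fin k → A K n)) (a : ℕ) : ℕ :=
  Module.finrank K ↥(Submodule.restrictScalars K M ⊓ homogSub d a)

/-- the homogeneous maximal ideal `m = (X_1,…,X_n)` of `A`. -/
noncomputable def mIdeal (K : Type*) [Field K] (n : ℕ) : Ideal (A K n) :=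
  RingHom.ker (MvPolynomial.constantCoeff : A K n →+* K)

/-- graded Betti number `β_{0,a}(M) = dim_K (M/mM)_a`, the number of minimal
generators of the graded module `M` in degree `a`. -/
noncomputable def beta0 (d : Fin k → ℕ) (M : Submodule (A K n) (Fin k → A K n)) (a : ℕ) : ℕ :=
  hilb d M a - hilb d (mIdeal K n • M) a

/-- A graded free resolution of a graded submodule `M` of `F = ⊕_j A(-d_j)`:
`⋯ → A^{rk 1} → A^{rk 0} → M → 0`, each free module coming with degree shifts
`sh i`, all maps graded of degree `0`. -/
structure GFRes (d : Fin k → ℕ) (M : Submodule (A K n) (Fin k → A K n)) where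
  rk : ℕ → ℕ
  sh : (i : ℕ) → Fin (rk i) → ℕ
  aug : (Fin (rk 0) → A K n) →ₗ[A K n] (Fin k → A K n)
  diff : (i : ℕ) → ((Fin (rk (i+1)) → A K n) →ₗ[A K n] (Fin (rk i) → A K n))
  aug_range : LinearMap.range aug = M
  aug_hom : ∀ l, IsHomog d (sh 0 l) (aug (Pi.single l 1))
  diff_hom : ∀ i l, IsHomog (sh i) (sh (i+1) l) (diff i (Pi.single l 1))
  ex0 : LinearMap.range (diff 0) = LinearMap.ker aug
  exs : ∀ i, LinearMap.range (diff (i+1)) = LinearMap.ker (diff i)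

/-- minimality of a graded free resolution: all entries of the differential
matrices lie in the maximal ideal. -/
def GFRes.Minimal {d : Fin k → ℕ} {M : Submodule (A K n) (Fin k → A K n)}
    (res : GFRes d M) : Prop :=
  ∀ i x l, res.diff i x l ∈ mIdeal K n

/-- the graded Betti number `β_{i,j}(M)` read off from a (minimal) resolution. -/
noncomputable def GFRes.betti {d : Fin k → ℕ} {M : Submodule (A K n) (Fin k → A K n)}
    (res : GFRes d M) (i j : ℕ) : ℕ :=
  (Finset.univ.filter fun l => res.sh i l = j).card

/-- `reg_A(M) ≤ r`: there is a minimal graded free resolution of `M` with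
all shifts in homological degree `i` bounded by `i + r`. -/
def RegLE (d : Fin k → ℕ) (M : Submodule (A K n) (Fin k → A K n)) (r : ℕ) : Prop :=
  ∃ res : GFRes d M, res.Minimal ∧ ∀ i l, res.sh i l ≤ i + r

/-- `M_{⟨a⟩}`: the submodule generated by the homogeneous elements of degree `a` of `M`. -/
noncomputable def compSub (d : Fin k → ℕ) (M : Submodule (A K n) (Fin k → A K n)) (a : ℕ) :
    Submodule (A K n) (Fin k → A K n) :=
  Submodule.span (A K n) {f | f ∈ M ∧ IsHomog d a f}

/-- `M` is `r`-componentwise regular: `reg (M_{⟨a⟩}) ≤ a + r` for all `a`. -/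
def CWRegLE (d : Fin k → ℕ) (M : Submodule (A K n) (Fin k → A K n)) (r : ℕ) : Prop :=
  ∀ a, RegLE d (compSub d M a) (a + r)

/-- `M` is componentwise linear: each `M_{⟨a⟩}` is zero or has regularity `a`. -/
def CompLinear (d : Fin k → ℕ) (M : Submodule (A K n) (Fin k → A K n)) : Prop :=
  ∀ a, compSub d M a = ⊥ ∨ RegLE d (compSub d M a) a

/-- `M` is generated in degrees `≤ a`. -/
def GenInDegLE (d : Fin k → ℕ) (M : Submodule (A K n) (Fin k → A K n)) (a : ℕ) : Prop :=
  M ≤ Submodule.span (A K n) {f | f ∈ M ∧ ∃ b ≤ a, IsHomog d b f}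

end CregPaper

namespace CregPaper


section WeightComponents

variable {K : Type*} [Field K] {n k m : ℕ}

lemma wdeg_add (ω : Fin n → ℕ) (u v : Fin n →₀ ℕ) :
    wdeg ω (u + v) = wdeg ω u + wdeg ω v :=
  Finsupp.sum_add_index' (by simp) (by intros; ring)

lemma tdeg_eq_wdeg (u : Fin n →₀ ℕ) : tdeg u = wdeg 1 u := by
  simp [tdeg, wdeg]

lemma coeff_sum_filter_monomial (p : A K n) (P : (Fin n →₀ ℕ) → Prop) [DecidablePred P]
    (u : Fin n →₀ ℕ) :
    (∑ v ∈ p.support.filter P, MvPolynomial.monomial v (p.coeff v)).coeff u =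
      if P u then p.coeff u else 0 := by
  classical
  simp only [MvPolynomial.coeff_sum, MvPolynomial.coeff_monomial, Finset.sum_ite_eq',
    Finset.mem_filter, MvPolynomial.mem_support_iff]
  grind

/-- The component of weight `w` of an element of a free module. -/
noncomputable def wcomp (ω : Fin n → ℕ) (ε : Fin k → ℕ) (w : ℕ) :
    (Fin k → A K n) →ₗ[K] (Fin k → A K n) where
  toFun f := fun j => ∑ u ∈ (f j).support.filter fun u => wdeg ω u + ε j = w,
    MvPolynomial.monomial u ((f j).coeff u)
  map_add' f g := by
    ext j v
    refine (coeff_sum_filter_monomial _ _ v).trans ?_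
    rw [Pi.add_apply, Pi.add_apply, MvPolynomial.coeff_add, MvPolynomial.coeff_add,
      coeff_sum_filter_monomial, coeff_sum_filter_monomial]
    split_ifs <;> simp
  map_smul' c f := by
    ext j v
    refine (coeff_sum_filter_monomial _ _ v).trans ?_
    rw [RingHom.id_apply, Pi.smul_apply, Pi.smul_apply, MvPolynomial.coeff_smul,
      MvPolynomial.coeff_smul, coeff_sum_filter_monomial]
    split_ifs <;> simp

lemma coeff_wcomp (ω : Fin n → ℕ) (ε : Fin k → ℕ) (w : ℕ) (f : Fin k → A K n) (j : Fin k)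
    (u : Fin n →₀ ℕ) :
    (wcomp ω ε w f j).coeff u = if wdeg ω u + ε j = w then (f j).coeff u else 0 :=
  coeff_sum_filter_monomial (f j) _ u

lemma inForm_eq_wcomp (ω : Fin n → ℕ) (ε : Fin k → ℕ) (f : Fin k → A K n) :
    inForm ω ε f = wcomp ω ε (maxWt ω ε f) f := rfl

lemma homogComp_eq_wcomp (d : Fin k → ℕ) (f : Fin k → A K n) (a : ℕ) :
    homogComp d f a = wcomp 1 d a f := by
  funext j
  simp only [homogComp, tdeg_eq_wdeg]
  rfl

lemma wcomp_comm (ω ω' : Fin n → ℕ) (ε ε' : Fin k → ℕ) (w w' : ℕ) (f : Fin k → A K n) :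
    wcomp ω ε w (wcomp ω' ε' w' f) = wcomp ω' ε' w' (wcomp ω ε w f) := by
  ext j u
  simp only [coeff_wcomp]
  split_ifs <;> rfl

lemma wcomp_wcomp_self (ω : Fin n → ℕ) (ε : Fin k → ℕ) (w : ℕ) (f : Fin k → A K n) :
    wcomp ω ε w (wcomp ω ε w f) = wcomp ω ε w f := by
  ext j u
  simp only [coeff_wcomp]
  split_ifs <;> rfl

lemma wcomp_wcomp_of_ne (ω : Fin n → ℕ) (ε : Fin k → ℕ) {w w' : ℕ} (h : w ≠ w')
    (f : Fin k → A K n) : wcomp ω ε w (wcomp ω ε w' f) = 0 := by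
  ext j u
  simp only [coeff_wcomp]
  split_ifs <;> first | rfl | (exfalso; omega)

lemma isHomog_iff {d : Fin k → ℕ} {a : ℕ} {f : Fin k → A K n} :
    IsHomog d a f ↔ wcomp 1 d a f = f := by
  constructor
  · intro h
    ext j u
    rw [coeff_wcomp]
    split_ifs with h1
    · rfl
    · by_contra h2
      exact h1 (tdeg_eq_wdeg u ▸ h j u (MvPolynomial.mem_support_iff.2 (Ne.symm h2)))
  · intro h j u hu
    rw [MvPolynomial.mem_support_iff, ← h, coeff_wcomp] at hu
    rw [tdeg_eq_wdeg]
    by_contra h1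
    simp [h1] at hu

lemma isHomog_wcomp (d : Fin k → ℕ) (a : ℕ) (f : Fin k → A K n) :
    IsHomog d a (wcomp 1 d a f) :=
  isHomog_iff.2 (wcomp_wcomp_self ..)

lemma IsHomog.wcomp {d : Fin k → ℕ} {a : ℕ} {f : Fin k → A K n} (h : IsHomog d a f)
    (ω : Fin n → ℕ) (ε : Fin k → ℕ) (w : ℕ) : IsHomog d a (wcomp ω ε w f) := by
  rw [isHomog_iff] at h ⊢
  rw [wcomp_comm, h]

lemma IsHomog.wcomp_of_ne {d : Fin k → ℕ} {a b : ℕ} {f : Fin k → A K n} (h : IsHomog d a f)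
    (hb : b ≠ a) : CregPaper.wcomp 1 d b f = 0 := by
  rw [← isHomog_iff.1 h, wcomp_wcomp_of_ne _ _ hb]

lemma wcomp_monomial_smul (ω : Fin n → ℕ) (ε : Fin k → ℕ) (w : ℕ) (u : Fin n →₀ ℕ) (c : K)
    (f : Fin k → A K n) :
    wcomp ω ε (wdeg ω u + w) (MvPolynomial.monomial u c • f) =
      MvPolynomial.monomial u c • wcomp ω ε w f := by
  ext j v
  simp only [coeff_wcomp, Pi.smul_apply, smul_eq_mul, MvPolynomial.coeff_monomial_mul']
  by_cases h : u ≤ v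
  · obtain ⟨v, rfl⟩ := exists_add_of_le h
    simp [wdeg_add, add_assoc]
  · simp [h]

lemma wcomp_monomial_smul_of_lt (ω : Fin n → ℕ) (ε : Fin k → ℕ) {w : ℕ} {u : Fin n →₀ ℕ}
    (h : w < wdeg ω u) (c : K) (f : Fin k → A K n) :
    wcomp ω ε w (MvPolynomial.monomial u c • f) = 0 := by
  ext j v
  simp only [coeff_wcomp, Pi.smul_apply, smul_eq_mul, MvPolynomial.coeff_monomial_mul']
  by_cases h : u ≤ v
  · obtain ⟨v, rfl⟩ := exists_add_of_le h
    have : ¬ wdeg ω (u + v) + ε j = w := by rw [wdeg_add]; omega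
    simp [this]
  · simp [h]

lemma IsHomog.monomial_smul {d : Fin k → ℕ} {a : ℕ} {f : Fin k → A K n} (h : IsHomog d a f)
    (u : Fin n →₀ ℕ) (c : K) : IsHomog d (tdeg u + a) (MvPolynomial.monomial u c • f) := by
  rw [isHomog_iff] at h ⊢
  rw [tdeg_eq_wdeg, wcomp_monomial_smul, h]

/-- Elements all of whose terms have weight less than `w`. -/
noncomputable def wlt (ω : Fin n → ℕ) (ε : Fin k → ℕ) (w : ℕ) :
    Submodule K (Fin k → A K n) where
  carrier := {f | ∀ j u, (f j).coeff u ≠ 0 → wdeg ω u + ε j < w}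
  add_mem' {f g} hf hg j u h := by
    by_cases h1 : (f j).coeff u = 0
    · exact hg j u (by simpa [h1] using h)
    · exact hf j u h1
  zero_mem' j u h := by simp at h
  smul_mem' c f hf j u h := hf j u (by
    intro h1
    simp [h1] at h)

lemma mem_wlt {ω : Fin n → ℕ} {ε : Fin k → ℕ} {w : ℕ} {f : Fin k → A K n} :
    f ∈ wlt ω ε w ↔ ∀ j u, (f j).coeff u ≠ 0 → wdeg ω u + ε j < w := Iff.rfl

lemma wlt_mono {ω : Fin n → ℕ} {ε : Fin k → ℕ} {w w' : ℕ} (h : w ≤ w') :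
    wlt (K := K) ω ε w ≤ wlt ω ε w' :=
  fun _ hf j u hu => (hf j u hu).trans_le h

lemma eq_zero_of_mem_wlt_zero {ω : Fin n → ℕ} {ε : Fin k → ℕ} {f : Fin k → A K n}
    (h : f ∈ wlt ω ε 0) : f = 0 := by
  ext j u
  by_contra h1
  exact absurd (h j u h1) (by omega)

lemma wcomp_eq_zero_of_mem_wlt {ω : Fin n → ℕ} {ε : Fin k → ℕ} {w v : ℕ} {f : Fin k → A K n}
    (h : f ∈ wlt ω ε w) (hv : w ≤ v) : wcomp ω ε v f = 0 := by
  ext j u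
  rw [coeff_wcomp]
  split_ifs with h1
  · by_contra h2
    exact absurd (h j u h2) (by omega)
  · rfl

lemma wcomp_mem_wlt (ω : Fin n → ℕ) (ε : Fin k → ℕ) (w : ℕ) (f : Fin k → A K n) :
    wcomp ω ε w f ∈ wlt ω ε (w + 1) := by
  intro j u h
  rw [coeff_wcomp] at h
  split_ifs at h
  · omega
  · exact absurd rfl h

lemma wcomp_mem_wlt_of_mem {ω ω' : Fin n → ℕ} {ε ε' : Fin k → ℕ} {w v : ℕ} {f : Fin k → A K n}
    (h : f ∈ wlt ω ε w) : wcomp ω' ε' v f ∈ wlt ω ε w := by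
  intro j u hu
  rw [coeff_wcomp] at hu
  split_ifs at hu
  · exact h j u hu
  · exact absurd rfl hu

lemma mem_wlt_of_wcomp_eq_zero {ω : Fin n → ℕ} {ε : Fin k → ℕ} {w : ℕ} {f : Fin k → A K n}
    (h : f ∈ wlt ω ε (w + 1)) (h0 : wcomp ω ε w f = 0) : f ∈ wlt ω ε w := by
  intro j u hu
  have h1 := h j u hu
  have h2 : wdeg ω u + ε j ≠ w := by
    intro h3
    have h4 := coeff_wcomp ω ε w f j u
    rw [h0, if_pos h3] at h4
    exact hu (by simpa using h4.symm)
  omega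

lemma mem_wlt_maxWt (ω : Fin n → ℕ) (ε : Fin k → ℕ) (f : Fin k → A K n) :
    f ∈ wlt ω ε (maxWt ω ε f + 1) := by
  intro j u hu
  have h1 : wdeg ω u + ε j ≤ (f j).support.sup fun u => wdeg ω u + ε j :=
    Finset.le_sup (f := fun u => wdeg ω u + ε j) (MvPolynomial.mem_support_iff.2 hu)
  have h2 : ((f j).support.sup fun u => wdeg ω u + ε j) ≤ maxWt ω ε f :=
    Finset.le_sup (f := fun j => (f j).support.sup fun u => wdeg ω u + ε j) (Finset.mem_univ j)
  omega

lemma maxWt_lt_of_mem_wlt {ω : Fin n → ℕ} {ε : Fin k → ℕ} {w : ℕ} {f : Fin k → A K n}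
    (h : f ∈ wlt ω ε (w + 1)) : maxWt ω ε f ≤ w := by
  refine Finset.sup_le fun j _ => Finset.sup_le fun u hu => ?_
  have := h j u (MvPolynomial.mem_support_iff.1 hu)
  omega

lemma monomial_smul_mem_wlt {ω : Fin n → ℕ} {ε : Fin k → ℕ} {w : ℕ} {f : Fin k → A K n}
    (h : f ∈ wlt ω ε w) (u : Fin n →₀ ℕ) (c : K) :
    MvPolynomial.monomial u c • f ∈ wlt ω ε (wdeg ω u + w) := by
  intro j v hv
  simp only [Pi.smul_apply, smul_eq_mul, MvPolynomial.coeff_monomial_mul'] at hv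
  split_ifs at hv with h1
  · obtain ⟨v, rfl⟩ := exists_add_of_le h1
    have := h j v (by intro h0; simp [h0] at hv)
    rw [wdeg_add]
    omega
  · exact absurd rfl hv

lemma sum_wcomp {ω : Fin n → ℕ} {ε : Fin k → ℕ} {w : ℕ} {f : Fin k → A K n}
    (h : f ∈ wlt ω ε w) : ∑ b ∈ Finset.range w, wcomp ω ε b f = f := by
  ext j u
  simp only [Finset.sum_apply, MvPolynomial.coeff_sum, coeff_wcomp, Finset.sum_ite_eq,
    Finset.mem_range]
  split_ifs with h1
  · rfl
  · by_contra h2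
    exact h1 (h j u (Ne.symm h2))

/-- Induction over the terms of an element of a free module. -/
lemma term_induction {p : (Fin m → A K n) → Prop} (t : Fin m → A K n) (zero : p 0)
    (add : ∀ x y, p x → p y → p (x + y))
    (term : ∀ i (u : Fin n →₀ ℕ) (c : K), (t i).coeff u ≠ 0 → p (MvPolynomial.monomial u c • (Pi.single i 1 : Fin m → A K n))) :
    p t := by
  have ht : t = ∑ i, ∑ u ∈ (t i).support,
      MvPolynomial.monomial u ((t i).coeff u) • (Pi.single i 1 : Fin m → A K n) := by
    conv_lhs => rw [pi_eq_sum_univ' t]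
    refine Finset.sum_congr rfl fun i _ => ?_
    rw [← Finset.sum_smul, ← MvPolynomial.as_sum]
  rw [ht]
  refine Finset.sum_induction _ p add zero fun i _ => Finset.sum_induction _ p add zero
    fun u hu => term i u _ (MvPolynomial.mem_support_iff.1 hu)

/-- A linear map sending basis vectors to weight homogeneous elements of the same weight commutes
with taking weight components. -/
lemma wcomp_map {ω : Fin n → ℕ} {ε : Fin k → ℕ} {ε' : Fin m → ℕ}
    (θ : (Fin m → A K n) →ₗ[A K n] (Fin k → A K n))
    (h : ∀ i, wcomp ω ε (ε' i) (θ (Pi.single i 1)) = θ (Pi.single i 1)) (w : ℕ)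
    (t : Fin m → A K n) : wcomp ω ε w (θ t) = θ (wcomp ω ε' w t) := by
  have hs : ∀ i, wcomp ω ε' (ε' i) (Pi.single i 1 : Fin m → A K n) = Pi.single i 1 := by
    intro i
    ext j u
    rw [coeff_wcomp]
    split_ifs with h1
    · rfl
    · by_cases hj : j = i
      · subst hj
        have : u ≠ 0 := by
          rintro rfl
          simp [wdeg] at h1
        simp [MvPolynomial.coeff_one, this.symm]
      · simp [hj]
  refine term_induction (p := fun t => wcomp ω ε w (θ t) = θ (wcomp ω ε' w t)) t (by simp)
    (fun x y hx hy => by simp only [map_add, hx, hy]) fun i u c _ => ?_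
  rw [map_smul]
  by_cases hw : w < wdeg ω u
  · rw [wcomp_monomial_smul_of_lt _ _ hw, wcomp_monomial_smul_of_lt _ _ hw, map_zero]
  · obtain ⟨v, rfl⟩ := exists_add_of_le (not_lt.1 hw)
    rw [wcomp_monomial_smul, wcomp_monomial_smul, map_smul]
    congr 1
    by_cases hv : v = ε' i
    · rw [hv, h, hs]
    · rw [← h, ← hs, wcomp_wcomp_of_ne _ _ hv, wcomp_wcomp_of_ne _ _ hv, map_zero]

lemma IsHomog.map {d : Fin k → ℕ} {d' : Fin m → ℕ}
    (θ : (Fin m → A K n) →ₗ[A K n] (Fin k → A K n))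
    (h : ∀ i, IsHomog d (d' i) (θ (Pi.single i 1))) {a : ℕ}
    {t : Fin m → A K n} (ht : IsHomog d' a t) : IsHomog d a (θ t) := by
  rw [isHomog_iff, wcomp_map θ (fun i => isHomog_iff.1 (h i)), isHomog_iff.1 ht]

/-- A linear map sending basis vectors to elements of bounded weight respects the weight
filtrations, and on leading components it is given by the leading components. -/
lemma wcomp_map_of_mem_wlt {ω : Fin n → ℕ} {ε : Fin k → ℕ} {ε' : Fin m → ℕ}
    (φ ψ : (Fin m → A K n) →ₗ[A K n] (Fin k → A K n))
    (hφ : ∀ i, φ (Pi.single i 1) ∈ wlt ω ε (ε' i + 1))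
    (hψ : ∀ i, ψ (Pi.single i 1) = wcomp ω ε (ε' i) (φ (Pi.single i 1))) {w : ℕ}
    {t : Fin m → A K n} (ht : t ∈ wlt ω ε' (w + 1)) :
    φ t ∈ wlt ω ε (w + 1) ∧ wcomp ω ε w (φ t) = ψ (wcomp ω ε' w t) := by
  rw [← wcomp_map ψ (fun i => by rw [hψ, wcomp_wcomp_self])]
  refine term_induction (p := fun t => φ t ∈ wlt ω ε (w + 1) ∧
    wcomp ω ε w (φ t) = wcomp ω ε w (ψ t)) t (by simp)
    (fun x y hx hy => ?_) fun i u c hu => ?_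
  · simp only [map_add]
    exact ⟨Submodule.add_mem _ hx.1 hy.1, by rw [hx.2, hy.2]⟩
  · have h1 := ht i u hu
    obtain ⟨v, rfl⟩ := exists_add_of_le (show wdeg ω u ≤ w by omega)
    simp only [map_smul]
    refine ⟨wlt_mono (by omega) (monomial_smul_mem_wlt (hφ i) u c), ?_⟩
    rw [wcomp_monomial_smul, wcomp_monomial_smul, hψ]
    congr 1
    by_cases hv : v = ε' i
    · rw [hv, wcomp_wcomp_self]
    · rw [wcomp_wcomp_of_ne _ _ hv, wcomp_eq_zero_of_mem_wlt (hφ i) (by omega)]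

lemma finite_homogSub (d : Fin k → ℕ) (a : ℕ) :
    FiniteDimensional K (homogSub (K := K) (n := n) d a) := by
  have hle : homogSub (K := K) (n := n) d a ≤ Submodule.span K
      (Set.range fun x : Fin k × (Fin n → Fin (a + 1)) =>
        (Pi.single x.1 (MvPolynomial.monomial
          (Finsupp.equivFunOnFinite.symm fun i => (x.2 i : ℕ)) 1) : Fin k → A K n)) := by
    intro f hf
    refine term_induction f (Submodule.zero_mem _) (fun _ _ => Submodule.add_mem _)
      fun j u c hu => ?_
    have hu' : tdeg u + d j = a := hf j u (MvPolynomial.mem_support_iff.2 hu)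
    have hui : ∀ i, u i < a + 1 := by
      intro i
      have : u i ≤ tdeg u := by
        rw [tdeg, Finsupp.sum_fintype _ _ (by simp)]
        exact Finset.single_le_sum (f := fun i => u i) (by simp) (Finset.mem_univ i)
      omega
    have h1 : MvPolynomial.monomial u c • (Pi.single j 1 : Fin k → A K n) =
        c • Pi.single j (MvPolynomial.monomial u 1) := by
      rw [← Pi.single_smul, ← Pi.single_smul, MvPolynomial.smul_monomial]
      simp
    rw [h1]
    refine Submodule.smul_mem _ _ (Submodule.subset_span ⟨(j, fun i => ⟨u i, hui i⟩), ?_⟩)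
    ext i
    simp
  have := FiniteDimensional.span_of_finite K (Set.finite_range
    fun x : Fin k × (Fin n → Fin (a + 1)) =>
      (Pi.single x.1 (MvPolynomial.monomial
        (Finsupp.equivFunOnFinite.symm fun i => (x.2 i : ℕ)) 1) : Fin k → A K n))
  exact Submodule.finiteDimensional_of_le hle

/-- The span of a set over the polynomial ring is spanned over the field by monomial multiples. -/
lemma mem_span_monomial_smul {S : Set (Fin k → A K n)} {f : Fin k → A K n}
    (hf : f ∈ Submodule.span (A K n) S) :
    f ∈ Submodule.span K {h | ∃ u, ∃ s ∈ S, h = (MvPolynomial.monomial u (1 : K) : A K n) • s} := by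
  induction hf using Submodule.span_induction with
  | mem x hx =>
    refine Submodule.subset_span ⟨0, x, hx, ?_⟩
    simp
  | zero => exact Submodule.zero_mem _
  | add x y _ _ hx hy => exact Submodule.add_mem _ hx hy
  | smul p x hx' hx =>
    clear hx'
    induction p using MvPolynomial.induction_on' with
    | monomial u c =>
      induction hx using Submodule.span_induction with
      | mem x hx =>
        obtain ⟨v, s, hs, rfl⟩ := hx
        have : MvPolynomial.monomial u c • (MvPolynomial.monomial v (1 : K) : A K n) • s =
            c • (MvPolynomial.monomial (u + v) (1 : K) : A K n) • s := by
          rw [smul_smul, MvPolynomial.monomial_mul, ← smul_assoc, MvPolynomial.smul_monomial]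
          simp
        rw [this]
        exact Submodule.smul_mem _ _ (Submodule.subset_span ⟨_, s, hs, rfl⟩)
      | zero => simp
      | add x y _ _ hx hy =>
        rw [smul_add]
        exact Submodule.add_mem _ hx hy
      | smul c x _ hx =>
        rw [smul_comm]
        exact Submodule.smul_mem _ _ hx
    | add p q hp hq =>
      rw [add_smul]
      exact Submodule.add_mem _ hp hq

end WeightComponents

section InitialModule

variable {K : Type*} [Field K] {n k m : ℕ}

lemma wcomp_mem_inMod {ω : Fin n → ℕ} {ε : Fin k → ℕ}
    {M : Submodule (A K n) (Fin k → A K n)} {f : Fin k → A K n} (hf : f ∈ M) {w : ℕ}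
    (h : f ∈ wlt ω ε (w + 1)) : wcomp ω ε w f ∈ inMod ω ε M := by
  by_cases h0 : wcomp ω ε w f = 0
  · rw [h0]
    exact Submodule.zero_mem _
  · have hw : maxWt ω ε f = w := le_antisymm (maxWt_lt_of_mem_wlt h) (by
      by_contra h1
      exact h0 (wcomp_eq_zero_of_mem_wlt (mem_wlt_maxWt ω ε f) (by omega)))
    refine Submodule.subset_span ⟨f, hf, ?_, by rw [inForm_eq_wcomp, hw]⟩
    rintro rfl
    simp at h0

/-- The initial module is spanned over the field by leading components of homogeneous elements. -/
lemma mem_span_of_mem_inMod {ω : Fin n → ℕ} {d ε : Fin k → ℕ}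
    {M : Submodule (A K n) (Fin k → A K n)} (hM : IsGradedSub d M) {h : Fin k → A K n}
    (hh : h ∈ inMod ω ε M) :
    h ∈ Submodule.span K {h | ∃ b w, ∃ f ∈ M, IsHomog d b f ∧ f ∈ wlt ω ε (w + 1) ∧
      h = wcomp ω ε w f} := by
  refine Submodule.span_le.2 ?_ (mem_span_monomial_smul hh)
  rintro _ ⟨u, _, ⟨f, hf, -, rfl⟩, rfl⟩
  have hsum := sum_wcomp (mem_wlt_maxWt 1 d f)
  have hin : inForm ω ε f = ∑ b ∈ Finset.range (maxWt 1 d f + 1),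
      wcomp ω ε (maxWt ω ε f) (wcomp 1 d b f) := by
    rw [inForm_eq_wcomp, ← map_sum, hsum]
  rw [hin, Finset.smul_sum]
  refine Submodule.sum_mem _ fun b _ => Submodule.subset_span
    ⟨tdeg u + b, wdeg ω u + maxWt ω ε f, MvPolynomial.monomial u 1 • wcomp 1 d b f,
      M.smul_mem _ (homogComp_eq_wcomp d f b ▸ hM f hf b),
      (isHomog_wcomp d b f).monomial_smul u 1, ?_, (wcomp_monomial_smul ..).symm⟩
  exact monomial_smul_mem_wlt (wcomp_mem_wlt_of_mem (mem_wlt_maxWt ω ε f)) u 1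

lemma wcomp_mem_span_of_mem_inMod {ω : Fin n → ℕ} {d ε : Fin k → ℕ}
    {M : Submodule (A K n) (Fin k → A K n)} (hM : IsGradedSub d M) {h : Fin k → A K n}
    (hh : h ∈ inMod ω ε M) (b : ℕ) :
    wcomp 1 d b h ∈ Submodule.span K {h | ∃ w, ∃ f ∈ M, IsHomog d b f ∧ f ∈ wlt ω ε (w + 1) ∧
      h = wcomp ω ε w f} := by
  refine Submodule.span_le (p := (Submodule.span K {h | ∃ w, ∃ f ∈ M, IsHomog d b f ∧
    f ∈ wlt ω ε (w + 1) ∧ h = wcomp ω ε w f}).comap (wcomp 1 d b)).2 ?_ (mem_span_of_mem_inMod hM hh)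
  rintro _ ⟨b', w, f, hf, hb', hw, rfl⟩
  by_cases hb : b = b'
  · subst hb
    exact Submodule.subset_span ⟨w, f, hf, hb', hw, isHomog_iff.1 (hb'.wcomp ω ε w)⟩
  · simp only [Submodule.comap_coe, Set.mem_preimage, (hb'.wcomp ω ε w).wcomp_of_ne hb]
    exact Submodule.zero_mem _

lemma wcomp_mem_inMod_of_mem_inMod {ω : Fin n → ℕ} {d ε : Fin k → ℕ}
    {M : Submodule (A K n) (Fin k → A K n)} (hM : IsGradedSub d M) {h : Fin k → A K n}
    (hh : h ∈ inMod ω ε M) (b : ℕ) : wcomp 1 d b h ∈ inMod ω ε M := by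
  refine Submodule.span_le (p := (inMod ω ε M).restrictScalars K).2 ?_
    (wcomp_mem_span_of_mem_inMod hM hh b)
  rintro _ ⟨w, f, hf, -, hw, rfl⟩
  exact wcomp_mem_inMod hf hw

/-- If the degree `c` part of `N` lies in `J`, so does the degree `c + 1` part of `mN`. -/
lemma wcomp_succ_mem_of_mem_mIdeal_smul {d : Fin k → ℕ}
    {N J : Submodule (A K n) (Fin k → A K n)} {c : ℕ} (hc : ∀ f ∈ N, wcomp 1 d c f ∈ J)
    {f : Fin k → A K n} (hf : f ∈ mIdeal K n • N) : wcomp 1 d (c + 1) f ∈ J := by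
  refine Submodule.smul_induction_on hf (fun p hp x hx => ?_) fun x y hx hy => ?_
  · rw [p.as_sum, Finset.sum_smul, map_sum]
    refine J.sum_mem fun u hu => ?_
    have hu0 : u ≠ 0 := by
      rintro rfl
      exact MvPolynomial.mem_support_iff.1 hu hp
    obtain ⟨i, hi⟩ := Finsupp.ne_iff.1 hu0
    have hle : Finsupp.single i 1 ≤ u := by
      rw [Finsupp.single_le_iff]
      exact Nat.one_le_iff_ne_zero.2 hi
    obtain ⟨v, rfl⟩ := exists_add_of_le hle
    have h1 : MvPolynomial.monomial (Finsupp.single i 1 + v)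
        (p.coeff (Finsupp.single i 1 + v)) • x =
        (MvPolynomial.monomial (Finsupp.single i 1) (1 : K) : A K n) •
          (MvPolynomial.monomial v (p.coeff (Finsupp.single i 1 + v)) : A K n) • x := by
      rw [smul_smul, MvPolynomial.monomial_mul, one_mul]
    have h2 : c + 1 = wdeg 1 (Finsupp.single i 1 : Fin n →₀ ℕ) + c := by
      simp [wdeg, add_comm]
    rw [h1, h2, wcomp_monomial_smul]
    exact J.smul_mem _ (hc _ (N.smul_mem _ hx))
  · rw [map_add]
    exact J.add_mem hx hy

lemma mem_mIdeal_smul_of_beta0_eq_zero {d : Fin k → ℕ} {N : Submodule (A K n) (Fin k → A K n)}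
    {c : ℕ} (h : beta0 d N c = 0) {f : Fin k → A K n} (hf : f ∈ N) (hc : IsHomog d c f) :
    f ∈ mIdeal K n • N := by
  have hrank : hilb d N c ≤ hilb d (mIdeal K n • N) c := Nat.sub_eq_zero_iff_le.1 h
  generalize hN' : mIdeal K n • N = N' at hrank ⊢
  have hN : N' ≤ N := hN' ▸ Submodule.smul_le_right
  have hfin := finite_homogSub (K := K) (n := n) d c
  have hfin' : FiniteDimensional K ↥(Submodule.restrictScalars K N ⊓ homogSub d c) :=
    Submodule.finiteDimensional_of_le inf_le_right
  have hle : Submodule.restrictScalars K N' ⊓ homogSub d c ≤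
      Submodule.restrictScalars K N ⊓ homogSub d c := fun x hx => ⟨hN hx.1, hx.2⟩
  have heq := Submodule.eq_of_le_of_finrank_le hle hrank
  have hmem : f ∈ Submodule.restrictScalars K N ⊓ homogSub d c := ⟨hf, hc⟩
  rw [← heq] at hmem
  exact hmem.1

/-- Without new generators in degrees `a + 1, …, e`, everything in degrees `a, …, e` comes from
degree `a`. -/
lemma wcomp_mem_compSub {d : Fin k → ℕ} {N : Submodule (A K n) (Fin k → A K n)}
    (hN : ∀ f ∈ N, ∀ b, wcomp 1 d b f ∈ N) {a e : ℕ}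
    (h : ∀ b, a + 1 ≤ b → b ≤ e → beta0 d N b = 0) (c : ℕ) (hac : a ≤ c) (hce : c ≤ e)
    (f : Fin k → A K n) (hf : f ∈ N) : wcomp 1 d c f ∈ compSub d N a := by
  induction c, hac using Nat.le_induction generalizing f with
  | base => exact Submodule.subset_span ⟨hN f hf a, isHomog_wcomp d a f⟩
  | succ c hac ih =>
    rw [← wcomp_wcomp_self]
    exact wcomp_succ_mem_of_mem_mIdeal_smul (fun f hf => ih (by omega) f hf)
      (mem_mIdeal_smul_of_beta0_eq_zero (h _ (by omega) hce) (hN f hf _) (isHomog_wcomp d _ f))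

lemma monomial_smul_mem_span_of_le {d : Fin k → ℕ} {M : Submodule (A K n) (Fin k → A K n)}
    {a c : ℕ} {h : Fin k → A K n} (hh : h ∈ M) (hc : IsHomog d c h) (hca : c ≤ a)
    (u : Fin n →₀ ℕ) (hu : a ≤ tdeg u + c) :
    (MvPolynomial.monomial u (1 : K) : A K n) • h ∈ compSub d M a := by
  obtain ⟨e, he⟩ := exists_add_of_le hu
  induction e generalizing u with
  | zero =>
    refine Submodule.subset_span ⟨M.smul_mem _ hh, ?_⟩
    rw [← add_zero a, ← he]
    exact hc.monomial_smul u 1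
  | succ e ih =>
    have hu0 : u ≠ 0 := by
      rintro rfl
      simp [tdeg] at he
      omega
    obtain ⟨i, hi⟩ := Finsupp.ne_iff.1 hu0
    have hle : Finsupp.single i 1 ≤ u := by
      rw [Finsupp.single_le_iff]
      exact Nat.one_le_iff_ne_zero.2 hi
    obtain ⟨v, rfl⟩ := exists_add_of_le hle
    have h2 : tdeg (Finsupp.single i 1 + v) = 1 + tdeg v := by
      rw [tdeg_eq_wdeg, wdeg_add, tdeg_eq_wdeg]
      simp [wdeg]
    have h1 : (MvPolynomial.monomial (Finsupp.single i 1 + v) (1 : K) : A K n) • h =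
        (MvPolynomial.monomial (Finsupp.single i 1) (1 : K) : A K n) •
          (MvPolynomial.monomial v (1 : K) : A K n) • h := by
      rw [smul_smul, MvPolynomial.monomial_mul, one_mul]
    rw [h1]
    exact Submodule.smul_mem _ _ (ih v (by omega) (by omega))

lemma mem_compSub_of_genInDegLE {d : Fin k → ℕ} {M : Submodule (A K n) (Fin k → A K n)}
    {a : ℕ} (hgen : GenInDegLE d M a) {b : ℕ} (hab : a ≤ b) {f : Fin k → A K n} (hf : f ∈ M)
    (hb : IsHomog d b f) : f ∈ compSub d M a := by
  rw [← isHomog_iff.1 hb]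
  refine Submodule.span_le (p := ((compSub d M a).restrictScalars K).comap (wcomp 1 d b)).2 ?_
    (mem_span_monomial_smul (hgen hf))
  rintro _ ⟨u, h, ⟨hh, c, hca, hc⟩, rfl⟩
  have hu := hc.monomial_smul u (1 : K)
  simp only [Submodule.comap_coe, Set.mem_preimage]
  by_cases hbu : b = tdeg u + c
  · rw [hbu, isHomog_iff.1 hu]
    exact monomial_smul_mem_span_of_le hh hc hca u (by omega)
  · rw [hu.wcomp_of_ne hbu]
    exact Submodule.zero_mem _

/-- Syzygies of a homogeneous generating family are generated in degrees bounded by the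
regularity. -/
lemma ker_le_of_regLE {d : Fin k → ℕ} {J : Submodule (A K n) (Fin k → A K n)} {e : ℕ}
    (hJ : RegLE d J e) (d' : Fin m → ℕ) (hd' : ∀ i, d' i ≤ e + 1)
    (ψ : (Fin m → A K n) →ₗ[A K n] (Fin k → A K n))
    (hψ : ∀ i, IsHomog d (d' i) (ψ (Pi.single i 1))) (hψJ : LinearMap.range ψ = J)
    (P : Submodule (A K n) (Fin m → A K n))
    (hP : ∀ c ≤ e + 1, ∀ s, ψ s = 0 → IsHomog d' c s → s ∈ P) : LinearMap.ker ψ ≤ P := by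
  obtain ⟨res, -, hsh⟩ := hJ
  have hα : ∀ i, ∃ y, res.aug y = ψ (Pi.single i 1) ∧ IsHomog (res.sh 0) (d' i) y := by
    intro i
    have hmem : ψ (Pi.single i 1) ∈ LinearMap.range res.aug := by
      rw [res.aug_range, ← hψJ]
      exact ⟨_, rfl⟩
    obtain ⟨y, hy⟩ := hmem
    refine ⟨wcomp 1 (res.sh 0) (d' i) y, ?_, isHomog_wcomp _ _ y⟩
    rw [← wcomp_map res.aug (fun l => isHomog_iff.1 (res.aug_hom l)), hy, isHomog_iff.1 (hψ i)]
  have hβ : ∀ l, ∃ y, ψ y = res.aug (Pi.single l 1) ∧ IsHomog d' (res.sh 0 l) y := by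
    intro l
    have hmem : res.aug (Pi.single l 1) ∈ LinearMap.range ψ := by
      rw [hψJ]
      exact res.aug_range.le ⟨_, rfl⟩
    obtain ⟨y, hy⟩ := hmem
    refine ⟨wcomp 1 d' (res.sh 0 l) y, ?_, isHomog_wcomp _ _ y⟩
    rw [← wcomp_map ψ (fun l => isHomog_iff.1 (hψ l)), hy, isHomog_iff.1 (res.aug_hom l)]
  choose α hα hαd using hα
  choose β hβ hβd using hβ
  let α' := Fintype.linearCombination (A K n) α
  let β' := Fintype.linearCombination (A K n) β
  have hα' : ∀ i, α' (Pi.single i 1) = α i := fun i => by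
    simp [α', Fintype.linearCombination_apply_single]
  have hβ' : ∀ i, β' (Pi.single i 1) = β i := fun i => by
    simp [β', Fintype.linearCombination_apply_single]
  have hαc : res.aug ∘ₗ α' = ψ := by
    refine LinearMap.pi_ext' fun i => LinearMap.ext_ring ?_
    simp [hα', hα]
  have hβc : ψ ∘ₗ β' = res.aug := by
    refine LinearMap.pi_ext' fun i => LinearMap.ext_ring ?_
    simp [hβ', hβ]
  have hβhom : ∀ {c y}, IsHomog (res.sh 0) c y → IsHomog d' c (β' y) := fun h =>
    h.map β' (fun l => by rw [hβ']; exact hβd l)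
  have h1 : ∀ y ∈ LinearMap.ker res.aug, β' y ∈ P := by
    rw [← res.ex0]
    rintro _ ⟨z, rfl⟩
    rw [pi_eq_sum_univ' z, map_sum, map_sum]
    refine P.sum_mem fun l _ => ?_
    have hl : (fun j => if l = j then 1 else 0 : Fin (res.rk 1) → A K n) = Pi.single l 1 := by
      funext j
      simp [Pi.single_apply, eq_comm]
    have hz : res.diff 0 (Pi.single l 1) ∈ LinearMap.ker res.aug := by
      rw [← res.ex0]
      exact ⟨_, rfl⟩
    have hs := hsh 1 l
    rw [map_smul, map_smul]
    refine P.smul_mem _ (hP (res.sh 1 l) (by omega) _ ?_ ?_)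
    · rw [← LinearMap.comp_apply, hβc]
      simpa [hl] using hz
    · exact hβhom (by simpa [hl] using res.diff_hom 0 l)
  let γ : (Fin m → A K n) →ₗ[A K n] (Fin m → A K n) := LinearMap.id - β' ∘ₗ α'
  have hγ : ∀ x, ψ (γ x) = 0 := by
    intro x
    have h3 : ψ (β' (α' x)) = ψ x := by
      rw [← LinearMap.comp_apply ψ, hβc, ← LinearMap.comp_apply, hαc]
    rw [LinearMap.sub_apply, map_sub, LinearMap.comp_apply, h3, LinearMap.id_apply, sub_self]
  have h2 : ∀ x, γ x ∈ P := by
    intro x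
    refine term_induction (p := fun x => γ x ∈ P) x (by simp)
      (fun x y hx hy => by rw [map_add]; exact P.add_mem hx hy) fun i u c _ => ?_
    rw [map_smul]
    refine P.smul_mem _ (hP (d' i) (hd' i) _ (hγ _) ?_)
    refine (homogSub d' (d' i)).sub_mem ?_ (hβhom (by rw [hα']; exact hαd i))
    intro j v hv
    by_cases hj : j = i
    · subst hj
      have hv0 : v = 0 := by simpa using hv
      simp [hv0, tdeg]
    · simp [hj] at hv
  intro x hx
  have hy := h1 (α' x) (by
    rw [LinearMap.mem_ker, ← LinearMap.comp_apply, hαc]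
    exact hx)
  simpa [γ] using P.add_mem (h2 x) hy

/-- In degrees where leading components come from the `ψ (e_i)`, elements of `M` can be written in
terms of the `φ (e_i)` without exceeding their weight. -/
lemma exists_mem_wlt_of_degree {ω : Fin n → ℕ} {d ε : Fin k → ℕ} {d' ε' : Fin m → ℕ}
    {M : Submodule (A K n) (Fin k → A K n)}
    (φ ψ : (Fin m → A K n) →ₗ[A K n] (Fin k → A K n))
    (hφ : ∀ i, φ (Pi.single i 1) ∈ wlt ω ε (ε' i + 1))
    (hψ : ∀ i, ψ (Pi.single i 1) = wcomp ω ε (ε' i) (φ (Pi.single i 1)))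
    (hd : ∀ i, IsHomog d (d' i) (φ (Pi.single i 1))) (hM : LinearMap.range φ ≤ M) {c : ℕ}
    (hlead : ∀ f ∈ M, IsHomog d c f → ∀ w, f ∈ wlt ω ε (w + 1) →
      wcomp ω ε w f ∈ LinearMap.range ψ)
    (w : ℕ) (f : Fin k → A K n) (hf : f ∈ M) (hc : IsHomog d c f) (hw : f ∈ wlt ω ε w) :
    ∃ t ∈ wlt ω ε' w, φ t = f := by
  induction w generalizing f with
  | zero => exact ⟨0, Submodule.zero_mem _, by rw [eq_zero_of_mem_wlt_zero hw, map_zero]⟩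
  | succ w ih =>
    obtain ⟨s, hs⟩ := hlead f hf hc w hw
    have hψw := fun i => show wcomp ω ε (ε' i) (ψ (Pi.single i 1)) = ψ (Pi.single i 1) by
      rw [hψ, wcomp_wcomp_self]
    have hψd : ∀ i, IsHomog d (d' i) (ψ (Pi.single i 1)) := fun i => by
      rw [hψ]
      exact (hd i).wcomp ω ε _
    let t := wcomp ω ε' w (wcomp 1 d' c s)
    have ht : ψ t = wcomp ω ε w f := by
      rw [← wcomp_map ψ hψw, ← wcomp_map ψ (fun i => isHomog_iff.1 (hψd i)), hs,
        isHomog_iff.1 (hc.wcomp ω ε w), wcomp_wcomp_self]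
    have htw : t ∈ wlt ω ε' (w + 1) := wcomp_mem_wlt ω ε' w _
    have htd : IsHomog d c (φ t) := ((isHomog_wcomp d' c s).wcomp ω ε' w).map φ hd
    obtain ⟨h1, h2⟩ := wcomp_map_of_mem_wlt φ ψ hφ hψ htw
    obtain ⟨t', ht', ht'f⟩ := ih (f - φ t) (M.sub_mem hf (hM ⟨t, rfl⟩))
      ((homogSub d c).sub_mem hc htd) (mem_wlt_of_wcomp_eq_zero (Submodule.sub_mem _ hw h1) (by
        rw [map_sub, h2, wcomp_wcomp_self, ht, sub_self]))
    exact ⟨t + t', Submodule.add_mem _ htw (wlt_mono (Nat.le_succ w) ht'), by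
      rw [map_add, ht'f]; abel⟩

/-- The elements whose weight components are mapped by `φ` to elements of smaller weight,
as witnessed by a representation. -/
noncomputable def liftableSyzygies (ω : Fin n → ℕ) (ε' : Fin m → ℕ)
    (φ : (Fin m → A K n) →ₗ[A K n] (Fin k → A K n)) :
    Submodule (A K n) (Fin m → A K n) where
  carrier := {s | ∀ w, ∃ t ∈ wlt ω ε' w, φ t = φ (wcomp ω ε' w s)}
  add_mem' {x y} hx hy w := by
    obtain ⟨t, ht, h⟩ := hx w
    obtain ⟨t', ht2, h2⟩ := hy w
    exact ⟨t + t', Submodule.add_mem _ ht ht2, by simp only [map_add, h, h2]⟩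
  zero_mem' w := ⟨0, Submodule.zero_mem _, by simp⟩
  smul_mem' p x hx w := by
    induction p using MvPolynomial.induction_on' with
    | monomial u c =>
      by_cases hw : w < wdeg ω u
      · exact ⟨0, Submodule.zero_mem _, by rw [wcomp_monomial_smul_of_lt _ _ hw]⟩
      · obtain ⟨v, rfl⟩ := exists_add_of_le (not_lt.1 hw)
        obtain ⟨t, ht, h⟩ := hx v
        exact ⟨MvPolynomial.monomial u c • t, monomial_smul_mem_wlt ht u c, by
          rw [wcomp_monomial_smul, map_smul, map_smul, h]⟩
    | add p q hp hq =>
      obtain ⟨t, ht, h⟩ := hp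
      obtain ⟨t', ht2, h2⟩ := hq
      exact ⟨t + t', Submodule.add_mem _ ht ht2, by rw [add_smul]; simp only [map_add, h, h2]⟩

/-- Buchberger's criterion: if all syzygies of the leading components lift, then leading
components of elements of the range of `φ` lie in the range of `ψ`. -/
lemma wcomp_mem_range_of_ker_le {ω : Fin n → ℕ} {ε : Fin k → ℕ} {ε' : Fin m → ℕ}
    (φ ψ : (Fin m → A K n) →ₗ[A K n] (Fin k → A K n))
    (hφ : ∀ i, φ (Pi.single i 1) ∈ wlt ω ε (ε' i + 1))
    (hψ : ∀ i, ψ (Pi.single i 1) = wcomp ω ε (ε' i) (φ (Pi.single i 1)))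
    (hker : LinearMap.ker ψ ≤ liftableSyzygies ω ε' φ) {w : ℕ} {f : Fin k → A K n}
    (hf : f ∈ LinearMap.range φ) (hw : f ∈ wlt ω ε (w + 1)) :
    wcomp ω ε w f ∈ LinearMap.range ψ := by
  have key : ∀ v, ∀ t ∈ wlt ω ε' (w + 1 + v), φ t = f → ∃ t ∈ wlt ω ε' (w + 1), φ t = f := by
    intro v
    induction v with
    | zero => exact fun t ht h => ⟨t, ht, h⟩
    | succ v ih =>
      intro t ht h
      have h1 : wcomp ω ε' (w + 1 + v) t ∈ LinearMap.ker ψ := by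
        rw [LinearMap.mem_ker, ← (wcomp_map_of_mem_wlt (w := w + 1 + v) φ ψ hφ hψ ht).2, h]
        exact wcomp_eq_zero_of_mem_wlt hw (by omega)
      obtain ⟨t', ht', h'⟩ := hker h1 (w + 1 + v)
      rw [wcomp_wcomp_self] at h'
      refine ih (t - wcomp ω ε' (w + 1 + v) t + t') (Submodule.add_mem _ ?_ ht') ?_
      · refine mem_wlt_of_wcomp_eq_zero (Submodule.sub_mem _ ht (wcomp_mem_wlt ω ε' _ t)) ?_
        rw [map_sub, wcomp_wcomp_self, sub_self]
      · rw [map_add, map_sub, h', h]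
        abel
  obtain ⟨t₀, ht₀⟩ := hf
  obtain ⟨t, ht, rfl⟩ := key _ t₀
    (wlt_mono (Nat.le_add_left _ (w + 1)) (mem_wlt_maxWt ω ε' t₀)) ht₀
  rw [(wcomp_map_of_mem_wlt φ ψ hφ hψ ht).2]
  exact ⟨_, rfl⟩

end InitialModule

/-- **Crystallization, Theorem 5.2.** Let `M ⊆ F` be generated in
degrees `≤ a`. If `in_{(ω,ε)}(M)` is `r`-componentwise regular and has no
minimal generators in degrees `a+1, …, a+1+r`, then `in_{(ω,ε)}(M)` is
generated in degrees `≤ a`. -/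
theorem crystallization
    {K : Type*} [Field K] {n k : ℕ} (ω : Fin n → ℕ) (d ε : Fin k → ℕ)
    (M : Submodule (A K n) (Fin k → A K n)) (hM : IsGradedSub d M)
    (a r : ℕ)
    (hgen : GenInDegLE d M a)
    (hcreg : CWRegLE d (inMod ω ε M) r)
    (hnogens : ∀ b, a + 1 ≤ b → b ≤ a + 1 + r → beta0 d (inMod ω ε M) b = 0) :
    GenInDegLE d (inMod ω ε M) a := by
  have hN : ∀ f ∈ inMod ω ε M, ∀ b, wcomp 1 d b f ∈ inMod ω ε M :=
    fun f hf b => wcomp_mem_inMod_of_mem_inMod hM hf b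
  let S : Set (Fin k → A K n) := {h | ∃ w, ∃ f ∈ M, IsHomog d a f ∧ f ∈ wlt ω ε (w + 1) ∧
    h = wcomp ω ε w f}
  have hS : ∀ h ∈ S, h ∈ inMod ω ε M ∧ IsHomog d a h := by
    rintro _ ⟨w, f, hf, ha, hw, rfl⟩
    exact ⟨wcomp_mem_inMod hf hw, ha.wcomp ω ε w⟩
  have hfg : (Submodule.span K S).FG := by
    have := finite_homogSub (K := K) (n := n) d a
    have hle : Submodule.span K S ≤ homogSub d a := Submodule.span_le.2 fun h hh => (hS h hh).2
    have := Submodule.finiteDimensional_of_le hle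
    exact Module.Finite.iff_fg.1 this
  obtain ⟨T, hTS, hT⟩ := (Submodule.fg_span_iff_fg_span_finset_subset S).1 hfg
  have hchoose : ∀ i : Fin T.card, ∃ w, ∃ f ∈ M, IsHomog d a f ∧ f ∈ wlt ω ε (w + 1) ∧
      (T.equivFin.symm i : Fin k → A K n) = wcomp ω ε w f :=
    fun i => hTS (T.equivFin.symm i).2
  choose ε' g hgM hga hgw hgT using hchoose
  let φ := Fintype.linearCombination (A K n) g
  let ψ := Fintype.linearCombination (A K n) fun i => wcomp ω ε (ε' i) (g i)
  have hφs : ∀ i, φ (Pi.single i 1) = g i := fun i => by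
    simp [φ, Fintype.linearCombination_apply_single]
  have hψs : ∀ i, ψ (Pi.single i 1) = wcomp ω ε (ε' i) (g i) := fun i => by
    simp [ψ, Fintype.linearCombination_apply_single]
  have hφM : LinearMap.range φ ≤ M := by
    rw [Fintype.range_linearCombination, Submodule.span_le]
    rintro _ ⟨i, rfl⟩
    exact hgM i
  have hSψ : Submodule.span K S ≤ (LinearMap.range ψ).restrictScalars K := by
    rw [hT, Submodule.span_le]
    intro h hh
    refine ⟨Pi.single (T.equivFin ⟨h, hh⟩) 1, ?_⟩
    rw [hψs, ← hgT, Equiv.symm_apply_apply]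
  have hψJ : LinearMap.range ψ = compSub d (inMod ω ε M) a := by
    refine le_antisymm ?_ (Submodule.span_le.2 ?_)
    · rw [Fintype.range_linearCombination]
      refine Submodule.span_mono ?_
      rintro _ ⟨i, rfl⟩
      exact ⟨wcomp_mem_inMod (hgM i) (hgw i), (hga i).wcomp ω ε _⟩
    · rintro f ⟨hf, ha⟩
      rw [← isHomog_iff.1 ha]
      exact hSψ (wcomp_mem_span_of_mem_inMod hM hf a)
  have hlead : ∀ c, a ≤ c → c ≤ a + 1 + r → ∀ f ∈ M, IsHomog d c f → ∀ w,
      f ∈ wlt ω ε (w + 1) → wcomp ω ε w f ∈ LinearMap.range ψ := by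
    intro c hac hcr f hf hc w hw
    rw [hψJ, ← isHomog_iff.1 (hc.wcomp ω ε w)]
    exact wcomp_mem_compSub hN hnogens c hac hcr _ (wcomp_mem_inMod hf hw)
  have hφw : ∀ i, φ (Pi.single i 1) ∈ wlt ω ε (ε' i + 1) := fun i => by
    rw [hφs]
    exact hgw i
  have hψφ : ∀ i, ψ (Pi.single i 1) = wcomp ω ε (ε' i) (φ (Pi.single i 1)) := fun i => by
    rw [hψs, hφs]
  have hφa : ∀ i, IsHomog d a (φ (Pi.single i 1)) := fun i => by
    rw [hφs]
    exact hga i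
  have hker : LinearMap.ker ψ ≤ liftableSyzygies ω ε' φ := by
    refine ker_le_of_regLE (hcreg a) (fun _ => a) (fun _ => by omega) ψ
      (fun i => by rw [hψs]; exact (hga i).wcomp ω ε _) hψJ _ fun c hc s hs hsc => ?_
    by_cases hac : a ≤ c
    · intro w
      have hsw := wcomp_map_of_mem_wlt φ ψ hφw hψφ (wcomp_mem_wlt ω ε' w s)
      refine exists_mem_wlt_of_degree (d' := fun _ => a) φ ψ hφw hψφ hφa hφM
        (hlead c hac (by omega)) w _ (hφM ⟨_, rfl⟩) ((hsc.wcomp ω ε' w).map φ hφa)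
        (mem_wlt_of_wcomp_eq_zero hsw.1 ?_)
      rw [hsw.2, wcomp_wcomp_self,
        ← wcomp_map ψ (fun i => by rw [hψs, wcomp_wcomp_self]), hs, map_zero]
    · have hs0 : s = 0 := by
        funext i
        rw [Pi.zero_apply, ← MvPolynomial.support_eq_empty, Finset.eq_empty_iff_forall_notMem]
        intro u hu
        exact hac (hsc i u hu ▸ Nat.le_add_left _ _)
      rw [hs0]
      exact Submodule.zero_mem _
  have hMφ : compSub d M a ≤ LinearMap.range φ := by
    refine Submodule.span_le.2 ?_
    rintro f ⟨hf, ha⟩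
    obtain ⟨t, -, ht⟩ := exists_mem_wlt_of_degree (d' := fun _ => a) φ ψ hφw hψφ hφa hφM
      (hlead a le_rfl (by omega)) _ f hf ha (mem_wlt_maxWt ω ε f)
    exact ⟨t, ht⟩
  intro h hh
  refine Submodule.span_le (p := (Submodule.span (A K n) {f | f ∈ inMod ω ε M ∧
    ∃ b ≤ a, IsHomog d b f}).restrictScalars K).2 ?_ (mem_span_of_mem_inMod hM hh)
  rintro _ ⟨b, w, f, hf, hb, hw, rfl⟩
  by_cases hba : b ≤ a
  · exact Submodule.subset_span ⟨wcomp_mem_inMod hf hw, b, hba, hb.wcomp ω ε w⟩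
  · have hmem := wcomp_mem_range_of_ker_le φ ψ hφw hψφ hker
      (hMφ (mem_compSub_of_genInDegLE hgen (by omega) hf hb)) hw
    rw [hψJ] at hmem
    refine Submodule.span_mono (s := {f | f ∈ inMod ω ε M ∧ IsHomog d a f}) ?_ hmem
    exact fun x hx => ⟨hx.1, a, le_rfl, hx.2⟩

end CregPaper
end
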